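/- Hölder stability for non-local advection-diffusion equations: let ν ≥ 0 (with ν > 0 in the diffusive case), 0 < γ ≤ 1, let v be a given smooth vector field, and let u be a smooth solution of ∂_t u + (v·∇)u + ν(−Δ)^γ u = f on 𝕋³ × [t₀,T] with u(·,t₀) = u₀. Assume 0 ≤ (t−t₀)[v]₁ ≤ 1. Then for all 0 ≤ α ≤ 1, ‖u(t)‖_α ≤ e^α (‖u₀‖_α + ∫_{t₀}^t ‖f(·,τ)‖_α dτ); and for every N ≥ 1 and 0 ≤ α < 1, [u(t)]_{N+α} ≲ [u₀]_{N+α} + (t−t₀)[v]_{N+α}[u₀]₁ + ∫_{t₀}^t ([f(τ)]_{N+α} + (t−τ)[v]_{N+α}[f(τ)]₁) dτ, where the implicit constant depends only on N and α. -/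

import Mathlib

open MeasureTheory Real Filter Set

noncomputable section

namespace FNS

/-! ## Basic setting: the torus `𝕋³ = ℝ³/ℤ³` realized as `ℤ³`-periodic functions on `ℝ³`. -/

/-- Points of space `ℝ³`. -/
abbrev Sp : Type := Fin 3 → ℝ
/-- Values of vector fields. -/
abbrev V3 : Type := Fin 3 → ℝ
/-- 3×3 real matrices (as nested functions). -/
abbrev Mat3 : Type := Fin 3 → Fin 3 → ℝ

/-- The fundamental domain of `𝕋³ = ℝ³/ℤ³` (of unit volume). -/
def unitCube : Set Sp := {x | ∀ i, x i ∈ Set.Ico (0 : ℝ) 1}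

/-- `ℤ³`-periodicity: a function defined on the torus. -/
def Per {E : Type*} (f : Sp → E) : Prop :=
  ∀ (x : Sp) (k : Fin 3 → ℤ), f (x + fun i => (k i : ℝ)) = f x

def dotIZ (k : Fin 3 → ℤ) (x : Sp) : ℝ := ∑ i, (k i : ℝ) * x i

/-- The character `e^{2πi k·x}` of the torus. -/
def eK (k : Fin 3 → ℤ) (x : Sp) : ℂ := Complex.exp (2 * π * Complex.I * dotIZ k x)

/-- The `k`-th Fourier coefficient of a periodic function. -/
def fCoeff (f : Sp → ℝ) (k : Fin 3 → ℤ) : ℂ :=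
  ∫ x in unitCube, (f x : ℂ) * eK (-k) x

/-- Euclidean length of a frequency `k ∈ ℤ³`. -/
def knorm (k : Fin 3 → ℤ) : ℝ := Real.sqrt (∑ i, ((k i : ℝ)) ^ 2)

/-- A Fourier multiplier operator on periodic functions. -/
def fourierMult (m : (Fin 3 → ℤ) → ℂ) (f : Sp → ℝ) (x : Sp) : ℝ :=
  (∑' k : Fin 3 → ℤ, m k * fCoeff f k * eK k x).re

/-- The fractional Laplacian `(-Δ)^γ`: the `k`-th Fourier coefficient is multiplied
by `|k|^{2γ}`. -/
def fracLap (γ : ℝ) (f : Sp → ℝ) : Sp → ℝ :=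
  fourierMult (fun k => ((knorm k ^ (2 * γ) : ℝ) : ℂ)) f

/-- The fractional Laplacian acting componentwise on vector fields. -/
def fracLapV (γ : ℝ) (u : Sp → V3) (x : Sp) (i : Fin 3) : ℝ :=
  fracLap γ (fun y => u y i) x

/-- `(-Δ)^{-1}` as a Fourier multiplier (killing the mean). -/
def invLap (f : Sp → ℝ) : Sp → ℝ :=
  fourierMult (fun k => if k = 0 then 0 else (((knorm k ^ 2)⁻¹ : ℝ) : ℂ)) f

/-- Spatial partial derivative `∂_j`. -/
def pd (j : Fin 3) (f : Sp → ℝ) (x : Sp) : ℝ := fderiv ℝ f x (Pi.single j 1)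

/-- Spatial divergence of a vector field. -/
def sdiv (u : Sp → V3) (x : Sp) : ℝ := ∑ j, pd j (fun y => u y j) x

/-- Spatial gradient matrix `(∇Φ)_{ij} = ∂_j Φ^i`. -/
def gradM (Φ : Sp → Sp) (x : Sp) : Mat3 := fun i j => pd j (fun y => Φ y i) x

/-- curl of a vector field. -/
def curlV (u : Sp → V3) (x : Sp) : V3 :=
  fun j => pd (j + 1) (fun y => u y (j + 2)) x - pd (j + 2) (fun y => u y (j + 1)) x

/-- The Biot–Savart operator `ℬ u = (-Δ)^{-1} curl u`. -/
def biot (u : Sp → V3) (x : Sp) (j : Fin 3) : ℝ := invLap (fun y => curlV u y j) x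

/-- Material derivative `(∂_t + w·∇)u` of a vector field. -/
def matder (w u : ℝ → Sp → V3) (t : ℝ) (x : Sp) (j : Fin 3) : ℝ :=
  deriv (fun s => u s x j) t + ∑ m, w t x m * pd m (fun y => u t y j) x

/-- Material derivative `(∂_t + w·∇)u` of a scalar. -/
def matderS (w : ℝ → Sp → V3) (u : ℝ → Sp → ℝ) (t : ℝ) (x : Sp) : ℝ :=
  deriv (fun s => u s x) t + ∑ m, w t x m * pd m (u t) x

/-- Material derivative `(∂_t + w·∇)R` of a matrix field, entrywise. -/
def matderM (w : ℝ → Sp → V3) (R : ℝ → Sp → Mat3) (t : ℝ) (x : Sp) : Mat3 :=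
  fun i j => deriv (fun s => R s x i j) t + ∑ m, w t x m * pd m (fun y => R t y i j) x

/-! ## Hölder norms (spatial, and with supremum in time) -/

/-- Supremum norm `‖f‖₀`. -/
def C0 {E : Type*} [NormedAddCommGroup E] (f : Sp → E) : ℝ := ⨆ x, ‖f x‖

/-- Seminorm `[f]_N = sup ‖D^N f‖`. -/
def semN {E : Type*} [NormedAddCommGroup E] [NormedSpace ℝ E] (N : ℕ) (f : Sp → E) : ℝ :=
  ⨆ x, ‖iteratedFDeriv ℝ N f x‖

/-- Hölder seminorm `[f]_{N+α}`. -/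
def semH {E : Type*} [NormedAddCommGroup E] [NormedSpace ℝ E] (N : ℕ) (α : ℝ) (f : Sp → E) : ℝ :=
  ⨆ p : {p : Sp × Sp // p.1 ≠ p.2},
    ‖iteratedFDeriv ℝ N f p.val.1 - iteratedFDeriv ℝ N f p.val.2‖ / ‖p.val.1 - p.val.2‖ ^ α

/-- Norm `‖f‖_N = Σ_{j≤N} [f]_j`. -/
def cNorm {E : Type*} [NormedAddCommGroup E] [NormedSpace ℝ E] (N : ℕ) (f : Sp → E) : ℝ :=
  ∑ j ∈ Finset.range (N + 1), semN j f

/-- Hölder norm `‖f‖_{N+α}`. -/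
def hNorm {E : Type*} [NormedAddCommGroup E] [NormedSpace ℝ E] (N : ℕ) (α : ℝ) (f : Sp → E) : ℝ :=
  cNorm N f + semH N α f

/-- Low Hölder norm `‖f‖_α = ‖f‖₀ + [f]_α`, `0 ≤ α ≤ 1`. -/
def nrmH {E : Type*} [NormedAddCommGroup E] [NormedSpace ℝ E] (α : ℝ) (f : Sp → E) : ℝ :=
  C0 f + semH 0 α f

def C0T {E : Type*} [NormedAddCommGroup E] (u : ℝ → Sp → E) (s T : ℝ) : ℝ :=
  ⨆ t ∈ Set.Icc s T, C0 (u t)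

def semNT {E : Type*} [NormedAddCommGroup E] [NormedSpace ℝ E] (N : ℕ) (u : ℝ → Sp → E)
    (s T : ℝ) : ℝ := ⨆ t ∈ Set.Icc s T, semN N (u t)

def semHT {E : Type*} [NormedAddCommGroup E] [NormedSpace ℝ E] (N : ℕ) (α : ℝ)
    (u : ℝ → Sp → E) (s T : ℝ) : ℝ := ⨆ t ∈ Set.Icc s T, semH N α (u t)

def cNormT {E : Type*} [NormedAddCommGroup E] [NormedSpace ℝ E] (N : ℕ) (u : ℝ → Sp → E)
    (s T : ℝ) : ℝ := ⨆ t ∈ Set.Icc s T, cNorm N (u t)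

def hNormT {E : Type*} [NormedAddCommGroup E] [NormedSpace ℝ E] (N : ℕ) (α : ℝ)
    (u : ℝ → Sp → E) (s T : ℝ) : ℝ := ⨆ t ∈ Set.Icc s T, hNorm N α (u t)

/-- The `C¹` norm `‖u‖₁ = ‖u‖₀ + [u]₁` in space, with supremum in time. -/
def c1T (u : ℝ → Sp → V3) (s T : ℝ) : ℝ := C0T u s T + semNT 1 u s T

/-! ## Smoothness and PDE predicates -/

/-- Jointly smooth in time and space. -/
def SmoothST {E : Type*} [NormedAddCommGroup E] [NormedSpace ℝ E] (u : ℝ → Sp → E) : Prop :=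
  ContDiff ℝ (⊤ : ℕ∞) (fun p : ℝ × Sp => u p.1 p.2)

/-- Periodic in space at each time. -/
def PerT {E : Type*} (u : ℝ → Sp → E) : Prop := ∀ t, Per (u t)

/-- Row divergence of a matrix field: `(div R)^j = ∑_m ∂_m R^{jm}`. -/
def divRow (R : Sp → Mat3) (x : Sp) (j : Fin 3) : ℝ := ∑ m, pd m (fun y => R y j m) x

/-- The fractional Navier–Stokes–Reynolds system, pointwise on a time interval. -/
def SolvesNSR (ν γ : ℝ) (v : ℝ → Sp → V3) (p : ℝ → Sp → ℝ) (R : ℝ → Sp → Mat3)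
    (I : Set ℝ) : Prop :=
  ∀ t ∈ I, ∀ x : Sp,
    (∀ j, matder v v t x j + pd j (p t) x + ν * fracLapV γ (v t) x j = divRow (R t) x j) ∧
    sdiv (v t) x = 0

/-- The fractional Navier–Stokes equations, pointwise on a time interval. -/
def SolvesNS (ν γ : ℝ) (v : ℝ → Sp → V3) (p : ℝ → Sp → ℝ) (I : Set ℝ) : Prop :=
  ∀ t ∈ I, ∀ x : Sp,
    (∀ j, matder v v t x j + pd j (p t) x + ν * fracLapV γ (v t) x j = 0) ∧
    sdiv (v t) x = 0

/-- Symmetric and trace-free matrix field. -/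
def SymTF (R : ℝ → Sp → Mat3) : Prop :=
  ∀ t x, (∀ i j, R t x i j = R t x j i) ∧ (∑ i, R t x i i) = 0

/-! ## Weak (Leray–Hopf) solutions -/

/-- Weakly divergence-free (against smooth periodic test functions). -/
def WeakDivFreeAt (u : Sp → V3) : Prop :=
  ∀ ψ : Sp → ℝ, ContDiff ℝ (⊤ : ℕ∞) ψ → Per ψ → ∫ x in unitCube, ∑ i, u x i * pd i ψ x = 0

/-- Smooth divergence-free test vector fields, periodic in space,
compactly supported in time. -/
def TestVF (φ : ℝ → Sp → V3) : Prop :=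
  SmoothST φ ∧ PerT φ ∧
  (∃ Ta Tb : ℝ, ∀ t, t < Ta ∨ Tb < t → φ t = 0) ∧
  (∀ t x, sdiv (φ t) x = 0)

/-- Kinetic energy `∫_{𝕋³} |v|²(x,t) dx`. -/
def kinEnergy (v : ℝ → Sp → V3) (t : ℝ) : ℝ := ∫ x in unitCube, ∑ i, (v t x i) ^ 2

/-- Instantaneous dissipation `∫_{𝕋³} |(-Δ)^{γ/2} v|²(x,t) dx`. -/
def dissEnergy (γ : ℝ) (v : ℝ → Sp → V3) (t : ℝ) : ℝ :=
  ∫ x in unitCube, ∑ i, (fracLapV (γ / 2) (v t) x i) ^ 2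

/-- Leray–Hopf weak solution of `∂_t v + div(v⊗v) + ∇p + ν(-Δ)^γ v = 0`, `div v = 0`,
`v(·,0) = v0`, on `ℝ⁺ × 𝕋³`:  `v ∈ L^∞(ℝ⁺,L²) ∩ L²(ℝ⁺,H^γ)`, the equation holds
distributionally against divergence-free test fields, and the global energy inequality
holds. -/
def IsLerayHopf (γ ν : ℝ) (v0 : Sp → V3) (v : ℝ → Sp → V3) : Prop :=
  PerT v ∧
  (∃ C, ∀ t, 0 ≤ t → kinEnergy v t ≤ C) ∧
  IntegrableOn (fun t => dissEnergy γ v t) (Set.Ioi 0) ∧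
  (∀ t, 0 ≤ t → WeakDivFreeAt (v t)) ∧
  (∀ φ, TestVF φ →
    (∫ t in Set.Ioi (0 : ℝ), ∫ x in unitCube,
      ((∑ i, v t x i * deriv (fun s => φ s x i) t)
        - ν * (∑ i, v t x i * fracLapV γ (φ t) x i)
        + ∑ i, ∑ j, v t x i * v t x j * pd j (fun y => φ t y i) x))
      = - ∫ x in unitCube, ∑ i, v0 x i * φ 0 x i) ∧
  (∀ s t : ℝ, 0 ≤ s → s < t →
    (1 / 2) * kinEnergy v t + ν * ∫ τ in Set.Ioc s t, dissEnergy γ v τ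
      ≤ (1 / 2) * kinEnergy v s)

/-- `C^β` Hölder continuity in space. -/
def HolderSp (β : ℝ) (f : Sp → V3) : Prop :=
  ∃ C, ∀ x y : Sp, ‖f x - f y‖ ≤ C * ‖x - y‖ ^ β

/-- `C^β` Hölder continuity in space-time on `𝕋³ × [0,T]`. -/
def HolderST (β T : ℝ) (v : ℝ → Sp → V3) : Prop :=
  ∃ C, ∀ t ∈ Set.Icc (0 : ℝ) T, ∀ t' ∈ Set.Icc (0 : ℝ) T, ∀ x y : Sp,
    ‖v t x - v t' y‖ ≤ C * (|t - t'| + ‖x - y‖) ^ β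

/-! ## Convex integration parameters -/

/-- Frequency `λ_q = 2π⌈a^{b^q}⌉`. -/
def lam (a b : ℝ) (q : ℕ) : ℝ := 2 * π * (⌈a ^ (b ^ q)⌉₊ : ℝ)

/-- Amplitude `δ_q = λ_q^{-2β}`. -/
def del (a b βv : ℝ) (q : ℕ) : ℝ := lam a b q ^ (-(2 * βv))

/-- Mollification scale `ℓ`. -/
def ellQ (a b βv α : ℝ) (q : ℕ) : ℝ :=
  del a b βv (q + 1) ^ ((1 : ℝ) / 2) * del a b βv q ^ (-(1 : ℝ) / 2)
    * lam a b q ^ (-(1 + 3 * α / 2))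

/-- Gluing time scale `τ_q = ℓ^{2α}/(δ_q^{1/2}λ_q)`. -/
def tauQ (a b βv α : ℝ) (q : ℕ) : ℝ :=
  ellQ a b βv α q ^ (2 * α) / (del a b βv q ^ ((1 : ℝ) / 2) * lam a b q)

/-- Mollification `f ∗ ψ_ℓ` with `ψ_ℓ(y) = ℓ^{-3}ψ(y/ℓ)`. -/
def mollify {E : Type*} [NormedAddCommGroup E] [NormedSpace ℝ E] (ψ : Sp → ℝ) (ℓ : ℝ)
    (f : Sp → E) (x : Sp) : E :=
  ∫ y : Sp, (ℓ ^ (-3 : ℤ) * ψ (ℓ⁻¹ • y)) • f (x - y)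

/-- A standard mollification kernel. -/
def StdKernel (ψ : Sp → ℝ) : Prop :=
  ContDiff ℝ (⊤ : ℕ∞) ψ ∧ (∀ x, 0 ≤ ψ x) ∧ (∀ x : Sp, 1 < ‖x‖ → ψ x = 0) ∧ (∫ x : Sp, ψ x) = 1

/-- Traceless tensor product `u ⊗̊ w`. -/
def otimesT (u w : V3) : Mat3 :=
  fun i j => u i * w j - if i = j then (∑ m, u m * w m) / 3 else 0

/-- The inverse-divergence operator `ℛ` of De Lellis–Székelyhidi:
`ℛ^{ijk} = -½Δ^{-2}∂_i∂_j∂_k - ½Δ^{-1}∂_kδ_{ij} + Δ^{-1}∂_iδ_{jk} + Δ^{-1}∂_jδ_{ik}`. -/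
def Rop (f : Sp → V3) (x : Sp) : Mat3 := fun i j =>
  (-(1 : ℝ) / 2) * pd i (fun y => pd j (fun z =>
      ∑ m, pd m (invLap (invLap (fun w => f w m))) z) y) x
  + (1 / 2) * (if i = j then ∑ m, pd m (invLap (fun w => f w m)) x else 0)
  - pd i (invLap (fun w => f w j)) x - pd j (invLap (fun w => f w i)) x

/-- The inductive hypotheses of the convex integration scheme at level `q`. -/
def IndHyp (a b βv α ν γ M T : ℝ) (e : ℝ → ℝ) (q : ℕ)
    (v : ℝ → Sp → V3) (p : ℝ → Sp → ℝ) (R : ℝ → Sp → Mat3) : Prop :=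
  SmoothST v ∧ SmoothST p ∧ SmoothST R ∧ PerT v ∧ PerT p ∧ PerT R ∧
  SolvesNSR ν γ v p R (Set.Icc 0 T) ∧ SymTF R ∧
  (∀ t, (∫ x in unitCube, p t x) = 0) ∧
  C0T R 0 T ≤ del a b βv (q + 1) * lam a b q ^ (-(3 * α)) ∧
  c1T v 0 T ≤ M * del a b βv q ^ ((1 : ℝ) / 2) * lam a b q ∧
  C0T v 0 T ≤ 1 - del a b βv q ^ ((1 : ℝ) / 2) ∧
  (∀ t ∈ Set.Icc (0 : ℝ) T,
    del a b βv (q + 1) * lam a b q ^ (-α) ≤ e t - kinEnergy v t ∧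
    e t - kinEnergy v t ≤ del a b βv (q + 1))

end FNS
namespace FNS

open scoped Topology

/-- The covering map `ℝ³ → 𝕋³`. -/
def toTorus (x : Sp) : UnitAddTorus (Fin 3) := fun i => (x i : UnitAddCircle)

/-- The function on the torus induced by a periodic function. -/
def torusLift {E : Type*} (f : Sp → E) (y : UnitAddTorus (Fin 3)) : E :=
  f (fun i => Quotient.out (y i))

lemma torusLift_toTorus {E : Type*} {f : Sp → E} (hf : Per f) (x : Sp) :
    torusLift f (toTorus x) = f x := by
  have h : ∀ i, ∃ k : ℤ, Quotient.out ((x i : ℝ) : UnitAddCircle) = x i + k := by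
    intro i
    have h1 : ((Quotient.out ((x i : ℝ) : UnitAddCircle) : ℝ) : UnitAddCircle) = (x i : ℝ) :=
      Quotient.out_eq _
    rw [← sub_eq_zero, ← AddCircle.coe_sub, AddCircle.coe_eq_zero_iff] at h1
    obtain ⟨n, hn⟩ := h1
    exact ⟨n, by rw [zsmul_eq_mul, mul_one] at hn; linarith⟩
  choose k hk using h
  unfold torusLift toTorus
  rw [← hf x k]
  congr 1
  funext i
  simp [hk]

lemma isOpenQuotientMap_toTorus : IsOpenQuotientMap toTorus := by
  exact IsOpenQuotientMap.piMap (fun i => QuotientAddGroup.isOpenQuotientMap_mk)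

lemma continuous_torusLift {E : Type*} [TopologicalSpace E] {f : Sp → E} (hf : Per f)
    (hc : Continuous f) : Continuous (torusLift f) := by
  rw [isOpenQuotientMap_toTorus.isQuotientMap.continuous_iff]
  convert hc using 1
  funext x
  exact torusLift_toTorus hf x

lemma mFourier_toTorus (k : Fin 3 → ℤ) (x : Sp) : UnitAddTorus.mFourier k (toTorus x) = eK k x := by
  simp only [UnitAddTorus.mFourier, toTorus, ContinuousMap.coe_mk, fourier_coe_apply, eK, dotIZ]
  rw [← Complex.exp_sum]
  congr 1
  push_cast
  rw [Finset.mul_sum]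
  refine Finset.sum_congr rfl fun i _ => ?_
  simp; ring

lemma unitCube_ae_eq : (unitCube : Set Sp) =ᵐ[volume] {x : Sp | ∀ i, x i ∈ Ioc ((0 : Sp) i) ((0 : Sp) i + 1)} := by
  have h1 : (unitCube : Set Sp) = Set.pi univ fun i => Ico ((0 : Sp) i) ((1 : Sp) i) := by
    ext x; simp [unitCube]
  have h2 : {x : Sp | ∀ i, x i ∈ Ioc ((0 : Sp) i) ((0 : Sp) i + 1)} = Set.pi univ fun i => Ioc ((0 : Sp) i) ((1 : Sp) i) := by
    ext x; simp
  rw [h1, h2]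
  exact (Measure.univ_pi_Ico_ae_eq_Icc).trans (Measure.univ_pi_Ioc_ae_eq_Icc).symm

lemma mFourierCoeff_torusLift {f : Sp → ℝ} (hf : Per f) (k : Fin 3 → ℤ) :
    UnitAddTorus.mFourierCoeff (torusLift fun x => (f x : ℂ)) k = fCoeff f k := by
  rw [UnitAddTorus.mFourierCoeff_eq_integral _ _ 0, fCoeff, setIntegral_congr_set unitCube_ae_eq]
  congr 1
  funext x
  have h1 := torusLift_toTorus (f := fun x => (f x : ℂ)) (fun x k => by simp only [hf x k]) x
  have h2 := mFourier_toTorus (-k) x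
  unfold toTorus at h1 h2
  rw [h1, h2, smul_eq_mul, mul_comm]

/-- Fourier inversion for continuous periodic functions with summable Fourier coefficients. -/
lemma hasSum_fCoeff {f : Sp → ℝ} (hf : Per f) (hc : Continuous f) (hs : Summable (fCoeff f))
    (x : Sp) : HasSum (fun k => fCoeff f k * eK k x) (f x : ℂ) := by
  have hp : Per fun x => (f x : ℂ) := fun x k => by simp only [hf x k]
  have hc' := continuous_torusLift hp (Complex.continuous_ofReal.comp hc)
  have e : (UnitAddTorus.mFourierCoeff (⟨_, hc'⟩ : C(UnitAddTorus (Fin 3), ℂ))) = fCoeff f := by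
    funext k; exact mFourierCoeff_torusLift hf k
  have := UnitAddTorus.hasSum_mFourier_series_apply_of_summable (f := ⟨_, hc'⟩) (by rw [e]; exact hs)
    (toTorus x)
  rw [e] at this
  simpa [mFourier_toTorus, torusLift_toTorus hp] using this

lemma norm_eK (k : Fin 3 → ℤ) (x : Sp) : ‖eK k x‖ = 1 := by
  rw [eK, show (2 * π * Complex.I * dotIZ k x : ℂ) = ((2 * π * dotIZ k x : ℝ) : ℂ) * Complex.I by
    push_cast; ring, Complex.norm_exp_ofReal_mul_I]

lemma eK_add (k : Fin 3 → ℤ) (x y : Sp) : eK k (x + y) = eK k x * eK k y := by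
  rw [eK, eK, eK, ← Complex.exp_add]
  congr 1
  simp only [dotIZ, Pi.add_apply, mul_add, Finset.sum_add_distrib]
  push_cast; ring

lemma continuous_eK (k : Fin 3 → ℤ) : Continuous (eK k) := by
  unfold eK dotIZ; fun_prop

lemma eK_int (k m : Fin 3 → ℤ) : eK k (fun i => (m i : ℝ)) = 1 := by
  rw [eK, Complex.exp_eq_one_iff]
  exact ⟨∑ i, k i * m i, by simp [dotIZ]; ring⟩

lemma knorm_nonneg (k : Fin 3 → ℤ) : 0 ≤ knorm k := Real.sqrt_nonneg _

lemma one_le_knorm {k : Fin 3 → ℤ} (hk : k ≠ 0) : 1 ≤ knorm k := by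
  obtain ⟨i, hi⟩ := Function.ne_iff.mp hk
  rw [knorm, Real.one_le_sqrt]
  have h1 : (1 : ℝ) ≤ (k i : ℝ) ^ 2 := by
    have h0 : (0 : ℤ) < (k i) ^ 2 := sq_pos_of_ne_zero hi
    exact_mod_cast h0
  exact h1.trans (Finset.single_le_sum (f := fun i => (k i : ℝ) ^ 2) (fun _ _ => sq_nonneg _)
    (Finset.mem_univ i))

open ProbabilityTheory

lemma summable_mul_eK {c : (Fin 3 → ℤ) → ℂ} (hc : Summable fun k => ‖c k‖) (x : Sp) :
    Summable fun k => c k * eK k x :=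
  Summable.of_norm (by simpa [norm_eK] using hc)

lemma continuous_tsum_eK {c : (Fin 3 → ℤ) → ℂ} (hc : Summable fun k => ‖c k‖) :
    Continuous fun x => ∑' k, c k * eK k x :=
  continuous_tsum (fun k => continuous_const.mul (continuous_eK k)) hc
    (fun k x => by simp [norm_eK])

/-- The Gaussian law on `ℝ³` whose characteristic function at `2πk` is `exp (-s |k|²)`. -/
def heatMeasure (s : ℝ) : Measure Sp :=
  Measure.pi fun _ : Fin 3 => gaussianReal 0 (s / (2 * π ^ 2)).toNNReal

instance (s : ℝ) : IsProbabilityMeasure (heatMeasure s) := by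
  unfold heatMeasure; infer_instance

lemma integral_eK_heatMeasure {s : ℝ} (hs : 0 ≤ s) (k : Fin 3 → ℤ) :
    ∫ z, eK k z ∂heatMeasure s = (Real.exp (-(s * knorm k ^ 2)) : ℂ) := by
  have h1 : ∀ z : Sp, eK k z = ∏ i, Complex.exp (((2 * π * k i : ℝ) : ℂ) * (z i : ℂ) * Complex.I) := by
    intro z
    rw [← Complex.exp_sum, eK, dotIZ]
    congr 1
    push_cast
    rw [Finset.mul_sum]
    refine Finset.sum_congr rfl fun i _ => ?_
    ring
  simp_rw [h1]
  unfold heatMeasure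
  rw [integral_fintype_prod_eq_prod
    (fun i (y : ℝ) => Complex.exp (((2 * π * k i : ℝ) : ℂ) * (y : ℂ) * Complex.I))]
  have h2 : ∀ i, ∫ y : ℝ, Complex.exp (((2 * π * k i : ℝ) : ℂ) * (y : ℂ) * Complex.I)
      ∂gaussianReal 0 (s / (2 * π ^ 2)).toNNReal = Complex.exp (-(s * (k i : ℝ) ^ 2 : ℝ)) := by
    intro i
    rw [← charFun_apply_real, charFun_gaussianReal]
    congr 1
    rw [Real.coe_toNNReal _ (by positivity)]
    push_cast
    have : (π : ℂ) ≠ 0 := by exact_mod_cast Real.pi_ne_zero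
    field_simp
    ring
  rw [Finset.prod_congr rfl fun i _ => h2 i, ← Complex.exp_sum, Complex.ofReal_exp]
  congr 1
  rw [knorm, Real.sq_sqrt (Finset.sum_nonneg fun _ _ => sq_nonneg _), Finset.mul_sum]
  push_cast
  rw [Finset.sum_neg_distrib]

/-- The heat semigroup does not increase suprema. -/
lemma re_heat_le {c : (Fin 3 → ℤ) → ℂ} (hc : Summable fun k => ‖c k‖) {s M : ℝ} (hs : 0 ≤ s)
    (hM : ∀ x, (∑' k, c k * eK k x).re ≤ M) (x : Sp) :
    (∑' k, (Real.exp (-(s * knorm k ^ 2)) : ℂ) * c k * eK k x).re ≤ M := by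
  have hint : ∀ k, Integrable (fun z : Sp => c k * eK k (x + z)) (heatMeasure s) := fun k =>
    Integrable.of_bound (by
      exact (continuous_const.mul ((continuous_eK k).comp (continuous_const.add continuous_id))).aestronglyMeasurable)
      ‖c k‖ (ae_of_all _ fun z => by simp [norm_eK])
  have hsum := hasSum_integral_of_summable_integral_norm hint (by simpa [norm_eK] using hc)
  have h1 : ∀ k, ∫ z, c k * eK k (x + z) ∂heatMeasure s
      = (Real.exp (-(s * knorm k ^ 2)) : ℂ) * c k * eK k x := by
    intro k
    simp_rw [eK_add, integral_const_mul]
    rw [integral_eK_heatMeasure hs]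
    ring
  simp_rw [h1] at hsum
  rw [hsum.tsum_eq]
  have hcont : Continuous fun z => ∑' k, c k * eK k (x + z) :=
    (continuous_tsum_eK hc).comp (continuous_const.add continuous_id)
  have hi : Integrable (fun z => ∑' k, c k * eK k (x + z)) (heatMeasure s) :=
    Integrable.of_bound hcont.aestronglyMeasurable (∑' k, ‖c k‖) (ae_of_all _ fun z => by
      refine (norm_tsum_le_tsum_norm (by simpa [norm_eK] using hc)).trans (le_of_eq ?_)
      simp [norm_eK])
  have h2 := integral_re (𝕜 := ℂ) hi
  simp only [RCLike.re_to_complex] at h2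
  rw [← h2]
  calc ∫ z, (∑' k, c k * eK k (x + z)).re ∂heatMeasure s ≤ ∫ _z, M ∂heatMeasure s :=
        integral_mono (by simpa using hi.re) (integrable_const _) (fun z => hM _)
    _ = M := by simp

/-- The density of the Lévy measure of the `γ`-stable subordinator, integrated against
`1 - exp (-lam s)`. -/
lemma integrableOn_subordinator {γ : ℝ} (h0 : 0 < γ) (h1 : γ < 1) {l : ℝ} (hl : 0 ≤ l) :
    IntegrableOn (fun s : ℝ => s ^ (-1 - γ) * (1 - Real.exp (-(s * l)))) (Ioi 0) := by
  have hm : ∀ S : Set ℝ, MeasurableSet S → S ⊆ Ioi 0 → AEStronglyMeasurable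
      (fun s : ℝ => s ^ (-1 - γ) * (1 - Real.exp (-(s * l)))) (volume.restrict S) := by
    intro S hS hS0
    refine ContinuousOn.aestronglyMeasurable ?_ hS
    refine ContinuousOn.mul (ContinuousOn.rpow_const continuousOn_id fun x hx => Or.inl ?_) (by fun_prop)
    exact ne_of_gt (hS0 hx)
  rw [← Ioc_union_Ioi_eq_Ioi (zero_le_one' ℝ)]
  refine IntegrableOn.union ?_ ?_
  · have hi : IntegrableOn (fun s : ℝ => l * s ^ (-γ)) (Ioc 0 1) := by
      have := (intervalIntegral.intervalIntegrable_rpow' (a := 0) (b := 1) (r := -γ) (by linarith))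
      rw [intervalIntegrable_iff_integrableOn_Ioc_of_le zero_le_one] at this
      exact this.const_mul l
    refine Integrable.mono' hi (hm _ measurableSet_Ioc fun x hx => hx.1) ?_
    refine (ae_restrict_iff' measurableSet_Ioc).mpr (ae_of_all _ fun s hs => ?_)
    have hs0 : 0 < s := hs.1
    have e1 : 0 ≤ 1 - Real.exp (-(s * l)) := by
      have : Real.exp (-(s * l)) ≤ 1 := Real.exp_le_one_iff.mpr (by nlinarith)
      linarith
    have e2 : 1 - Real.exp (-(s * l)) ≤ s * l := by
      have := Real.add_one_le_exp (-(s * l)); linarith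
    have hp : 0 ≤ s ^ (-1 - γ) := Real.rpow_nonneg hs0.le _
    rw [Real.norm_of_nonneg (mul_nonneg hp e1)]
    calc s ^ (-1 - γ) * (1 - Real.exp (-(s * l))) ≤ s ^ (-1 - γ) * (s * l) := by gcongr
      _ = l * (s ^ (-1 - γ) * s ^ (1 : ℝ)) := by rw [Real.rpow_one]; ring
      _ = l * s ^ (-γ) := by rw [← Real.rpow_add hs0]; ring_nf
  · have hi : IntegrableOn (fun s : ℝ => s ^ (-1 - γ)) (Ioi 1) :=
      integrableOn_Ioi_rpow_of_lt (by linarith) one_pos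
    refine Integrable.mono' hi (hm _ measurableSet_Ioi fun x (hx : 1 < x) => show 0 < x from lt_trans one_pos hx) ?_
    refine (ae_restrict_iff' measurableSet_Ioi).mpr (ae_of_all _ fun s hs => ?_)
    have hs0 : 0 < s := lt_trans one_pos hs
    have e1 : 0 ≤ 1 - Real.exp (-(s * l)) := by
      have : Real.exp (-(s * l)) ≤ 1 := Real.exp_le_one_iff.mpr (by nlinarith)
      linarith
    have hp : 0 ≤ s ^ (-1 - γ) := Real.rpow_nonneg hs0.le _
    rw [Real.norm_of_nonneg (mul_nonneg hp e1)]
    have := Real.exp_pos (-(s * l))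
    nlinarith

/-- The normalizing constant in the subordination formula. -/
def subConst (γ : ℝ) : ℝ := ∫ s in Ioi (0 : ℝ), s ^ (-1 - γ) * (1 - Real.exp (-(s * 1)))

lemma subConst_pos {γ : ℝ} (h0 : 0 < γ) (h1 : γ < 1) : 0 < subConst γ := by
  unfold subConst
  have hpos : ∀ s ∈ Ioi (0 : ℝ), 0 < s ^ (-1 - γ) * (1 - Real.exp (-(s * 1))) := by
    intro s hs
    have : Real.exp (-(s * 1)) < 1 := Real.exp_lt_one_iff.mpr (by simpa using hs)
    exact mul_pos (Real.rpow_pos_of_pos hs _) (by linarith)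
  rw [setIntegral_pos_iff_support_of_nonneg_ae]
  · have : Function.support (fun s : ℝ => s ^ (-1 - γ) * (1 - Real.exp (-(s * 1)))) ∩ Ioi 0 = Ioi 0 :=
      inter_eq_right.mpr fun s hs => (hpos s hs).ne'
    rw [this]; simp
  · exact (ae_restrict_iff' measurableSet_Ioi).mpr (ae_of_all _ fun s hs => (hpos s hs).le)
  · exact integrableOn_subordinator h0 h1 zero_le_one

lemma integral_subordinator {γ : ℝ} (h0 : 0 < γ) {l : ℝ} (hl : 0 ≤ l) :
    ∫ s in Ioi (0 : ℝ), s ^ (-1 - γ) * (1 - Real.exp (-(s * l))) = l ^ γ * subConst γ := by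
  rcases hl.eq_or_lt with rfl | hl
  · simp [Real.zero_rpow h0.ne']
  have := integral_comp_mul_left_Ioi (fun s : ℝ => s ^ (-1 - γ) * (1 - Real.exp (-(s * 1)))) 0 hl
  simp only [mul_zero, smul_eq_mul] at this
  unfold subConst
  have h2 : ∫ s in Ioi (0 : ℝ), (l * s) ^ (-1 - γ) * (1 - Real.exp (-(l * s * 1)))
      = l ^ (-1 - γ) * ∫ s in Ioi (0 : ℝ), s ^ (-1 - γ) * (1 - Real.exp (-(s * l))) := by
    rw [← integral_const_mul]
    refine setIntegral_congr_fun measurableSet_Ioi fun s hs => ?_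
    rw [Real.mul_rpow hl.le (le_of_lt hs), show l * s * 1 = s * l by ring]
    ring
  rw [h2] at this
  have h3 : l ^ (1 + γ) * l ^ (-1 - γ) = 1 := by
    rw [← Real.rpow_add hl]; ring_nf; simp
  have h4 : l ^ (1 + γ) * l⁻¹ = l ^ γ := by
    rw [← Real.rpow_neg_one l, ← Real.rpow_add hl]; ring_nf
  rw [← h4, mul_assoc, ← this, ← mul_assoc, h3, one_mul]

lemma re_one_sub_heat_nonneg {c : (Fin 3 → ℤ) → ℂ} (hc : Summable fun k => ‖c k‖) {x₀ : Sp}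
    (hmax : ∀ x, (∑' k, c k * eK k x).re ≤ (∑' k, c k * eK k x₀).re) {s : ℝ} (hs : 0 ≤ s) :
    0 ≤ (∑' k, ((1 - Real.exp (-(s * knorm k ^ 2)) : ℝ) : ℂ) * c k * eK k x₀).re := by
  have h1 := re_heat_le hc hs hmax x₀
  have hs1 := summable_mul_eK hc x₀
  have hs2 : Summable fun k => (Real.exp (-(s * knorm k ^ 2)) : ℂ) * c k * eK k x₀ := by
    refine summable_mul_eK (c := fun k => (Real.exp (-(s * knorm k ^ 2)) : ℂ) * c k) ?_ x₀
    refine Summable.of_nonneg_of_le (fun _ => norm_nonneg _) (fun k => ?_) hc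
    rw [norm_mul, Complex.norm_real, Real.norm_of_nonneg (Real.exp_pos _).le]
    exact mul_le_of_le_one_left (norm_nonneg _) (Real.exp_le_one_iff.mpr (by
      have := sq_nonneg (knorm k); nlinarith))
  have : (∑' k, ((1 - Real.exp (-(s * knorm k ^ 2)) : ℝ) : ℂ) * c k * eK k x₀)
      = ∑' k, c k * eK k x₀ - ∑' k, (Real.exp (-(s * knorm k ^ 2)) : ℂ) * c k * eK k x₀ := by
    rw [← hs1.tsum_sub hs2]
    congr 1; funext k; push_cast; ring
  rw [this, Complex.sub_re]
  linarith

/-- The maximum principle for the fractional Laplacian, in terms of Fourier series. -/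
lemma re_fracSeries_nonneg {γ : ℝ} (h0 : 0 < γ) (h1 : γ ≤ 1) {c : (Fin 3 → ℤ) → ℂ}
    (hc : Summable fun k => ‖c k‖) (hc2 : Summable fun k => knorm k ^ (2 * γ) * ‖c k‖) {x₀ : Sp}
    (hmax : ∀ x, (∑' k, c k * eK k x).re ≤ (∑' k, c k * eK k x₀).re) :
    0 ≤ (∑' k, ((knorm k ^ (2 * γ) : ℝ) : ℂ) * c k * eK k x₀).re := by
  have hkk : ∀ k, knorm k ^ (2 * γ) = (knorm k ^ 2) ^ γ := fun k => by
    rw [Real.rpow_mul (knorm_nonneg k)]; norm_cast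
  have hE : ∀ (s : ℝ) k, 0 ≤ s → 0 ≤ 1 - Real.exp (-(s * knorm k ^ 2)) := by
    intro s k hs
    have : Real.exp (-(s * knorm k ^ 2)) ≤ 1 := Real.exp_le_one_iff.mpr (by
      have := sq_nonneg (knorm k); nlinarith)
    linarith
  rcases h1.lt_or_eq with h1 | rfl
  · let F : (Fin 3 → ℤ) → ℝ → ℂ := fun k s =>
      ((s ^ (-1 - γ) * (1 - Real.exp (-(s * knorm k ^ 2))) : ℝ) : ℂ) * (c k * eK k x₀)
    have hFi : ∀ k, Integrable (F k) (volume.restrict (Ioi 0)) := fun k =>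
      (Integrable.ofReal (integrableOn_subordinator h0 h1 (sq_nonneg _))).mul_const _
    have hF : ∀ k, ∫ s in Ioi (0 : ℝ), F k s
        = (subConst γ : ℂ) * (((knorm k ^ (2 * γ) : ℝ) : ℂ) * c k * eK k x₀) := by
      intro k
      simp only [F]
      rw [integral_mul_const, integral_complex_ofReal, integral_subordinator h0 (sq_nonneg _), hkk]
      push_cast; ring
    have hFn : ∀ k, ∫ s in Ioi (0 : ℝ), ‖F k s‖ = subConst γ * (knorm k ^ (2 * γ) * ‖c k‖) := by
      intro k
      have : ∀ s ∈ Ioi (0 : ℝ), ‖F k s‖ = s ^ (-1 - γ) * (1 - Real.exp (-(s * knorm k ^ 2))) * ‖c k‖ := by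
        intro s hs
        simp only [F, norm_mul, norm_eK, mul_one, Complex.norm_real]
        rw [Real.norm_of_nonneg (Real.rpow_nonneg (le_of_lt hs) _), Real.norm_of_nonneg (hE s k (le_of_lt hs))]
      rw [setIntegral_congr_fun measurableSet_Ioi this, integral_mul_const,
        integral_subordinator h0 (sq_nonneg _), hkk]
      ring
    have hsum := hasSum_integral_of_summable_integral_norm hFi (by
      simp_rw [hFn]; exact hc2.mul_left _)
    simp_rw [hF] at hsum
    have hs1 : Summable fun k => ((knorm k ^ (2 * γ) : ℝ) : ℂ) * c k * eK k x₀ := by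
      refine summable_mul_eK (c := fun k => ((knorm k ^ (2 * γ) : ℝ) : ℂ) * c k) ?_ x₀
      simpa [norm_mul, abs_of_nonneg (Real.rpow_nonneg (knorm_nonneg _) _)] using hc2
    have heq := (hs1.hasSum.mul_left (subConst γ : ℂ)).unique hsum
    have hre : subConst γ * (∑' k, ((knorm k ^ (2 * γ) : ℝ) : ℂ) * c k * eK k x₀).re
        = (∫ s in Ioi (0 : ℝ), ∑' k, F k s).re := by
      rw [← heq, Complex.re_ofReal_mul]
    have hge : 0 ≤ (∫ s in Ioi (0 : ℝ), ∑' k, F k s).re := by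
      by_cases hi : Integrable (fun s => ∑' k, F k s) (volume.restrict (Ioi 0))
      · have h2 := integral_re (𝕜 := ℂ) hi
        simp only [RCLike.re_to_complex] at h2
        rw [← h2]
        refine setIntegral_nonneg measurableSet_Ioi fun s hs => ?_
        have : ∑' k, F k s = ((s ^ (-1 - γ) : ℝ) : ℂ) *
            ∑' k, ((1 - Real.exp (-(s * knorm k ^ 2)) : ℝ) : ℂ) * c k * eK k x₀ := by
          rw [← tsum_mul_left]
          congr 1; funext k; simp only [F]; push_cast; ring
        rw [this, Complex.re_ofReal_mul]
        exact mul_nonneg (Real.rpow_nonneg (le_of_lt hs) _)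
          (re_one_sub_heat_nonneg hc hmax (le_of_lt hs))
      · rw [integral_undef hi]; simp
    rw [← hre] at hge
    exact nonneg_of_mul_nonneg_right hge (subConst_pos h0 h1)
  · have hlim : ∀ k, Tendsto (fun s : ℝ => ((s⁻¹ * (1 - Real.exp (-(s * knorm k ^ 2))) : ℝ) : ℂ) * c k * eK k x₀)
        (𝓝[>] 0) (𝓝 (((knorm k ^ (2 * (1 : ℝ)) : ℝ) : ℂ) * c k * eK k x₀)) := by
      intro k
      refine Tendsto.mul_const _ (Tendsto.mul_const _ ?_)
      refine (Complex.continuous_ofReal.tendsto _).comp ?_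
      have hd : HasDerivAt (fun s : ℝ => 1 - Real.exp (-(s * knorm k ^ 2))) (knorm k ^ (2 * (1 : ℝ))) 0 := by
        have := (((hasDerivAt_id (0 : ℝ)).mul_const (knorm k ^ 2)).neg.exp).const_sub 1
        have e : knorm k ^ (2 * (1 : ℝ))
            = -(rexp ((-fun y => id y * knorm k ^ 2) 0) * -(1 * knorm k ^ 2)) := by
          rw [show (2 * (1 : ℝ)) = ((2 : ℕ) : ℝ) by norm_num, Real.rpow_natCast]
          simp
        rw [e]
        exact this
      have := hd.tendsto_slope_zero_right
      simpa using this
    have ht := tendsto_tsum_of_dominated_convergence hc2 hlim (by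
      filter_upwards [self_mem_nhdsWithin] with s hs k
      have hs' : 0 < s := hs
      rw [norm_mul, norm_eK, mul_one, norm_mul, Complex.norm_real,
        Real.norm_of_nonneg (mul_nonneg (inv_nonneg.mpr hs'.le) (hE s k hs'.le))]
      gcongr
      rw [inv_mul_le_iff₀ hs']
      have := Real.add_one_le_exp (-(s * knorm k ^ 2))
      rw [show (2 * (1 : ℝ)) = ((2 : ℕ) : ℝ) by norm_num, Real.rpow_natCast]
      linarith)
    refine ge_of_tendsto ((Complex.continuous_re.tendsto _).comp ht) ?_
    filter_upwards [self_mem_nhdsWithin] with s hs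
    have hs' : 0 < s := hs
    have : ∑' k, ((s⁻¹ * (1 - Real.exp (-(s * knorm k ^ 2))) : ℝ) : ℂ) * c k * eK k x₀ = ((s⁻¹ : ℝ) : ℂ) *
            ∑' k, ((1 - Real.exp (-(s * knorm k ^ 2)) : ℝ) : ℂ) * c k * eK k x₀ := by
      rw [← tsum_mul_left]
      congr 1; funext k; push_cast; ring
    rw [Function.comp_apply, this, Complex.re_ofReal_mul]
    exact mul_nonneg (inv_nonneg.mpr hs'.le) (re_one_sub_heat_nonneg hc hmax hs'.le)

/-- The maximum principle for all finite combinations of translates of a pair of functions. -/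
def TransMax (φ Φ : Sp → ℝ) : Prop :=
  ∀ (ι : Type) [Fintype ι] (a : ι → ℝ) (h : ι → Sp) (M : ℝ),
    (∀ x, ∑ i, a i * (φ (x + h i) + Φ (x + h i)) ≤ M) → ∀ x, ∑ i, a i * φ (x + h i) ≤ M

lemma exists_max_of_per {φ : Sp → ℝ} (hp : Per φ) (hc : Continuous φ) :
    ∃ x₀, ∀ x, φ x ≤ φ x₀ := by
  obtain ⟨y, -, hy⟩ := isCompact_univ.exists_isMaxOn (univ_nonempty (α := UnitAddTorus (Fin 3)))
    (continuous_torusLift hp hc).continuousOn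
  refine ⟨fun i => Quotient.out (y i), fun x => ?_⟩
  have := hy (mem_univ (toTorus x))
  simp only [mem_ofPred_eq, torusLift_toTorus hp] at this
  exact this

lemma transMax_of_series {γ κ : ℝ} (h0 : 0 < γ) (h1 : γ ≤ 1) (hκ : 0 ≤ κ) {c : (Fin 3 → ℤ) → ℂ}
    (hc : Summable fun k => ‖c k‖) (hc2 : Summable fun k => knorm k ^ (2 * γ) * ‖c k‖) :
    TransMax (fun x => (∑' k, c k * eK k x).re)
      (fun x => κ * (∑' k, ((knorm k ^ (2 * γ) : ℝ) : ℂ) * c k * eK k x).re) := by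
  intro ι _ a h M hM x
  let b : (Fin 3 → ℤ) → ℂ := fun k => ∑ i, (a i : ℂ) * eK k (h i)
  have hb : ∀ k, ‖b k‖ ≤ ∑ i, |a i| := fun k =>
    (norm_sum_le _ _).trans (Finset.sum_le_sum fun i _ => by simp [norm_eK])
  have hbc : Summable fun k => ‖c k * b k‖ :=
    Summable.of_nonneg_of_le (fun _ => norm_nonneg _)
      (fun k => by rw [norm_mul]; exact mul_le_mul_of_nonneg_left (hb k) (norm_nonneg _))
      (hc.mul_right _)
  have hbc2 : Summable fun k => knorm k ^ (2 * γ) * ‖c k * b k‖ :=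
    Summable.of_nonneg_of_le
      (fun k => mul_nonneg (Real.rpow_nonneg (knorm_nonneg _) _) (norm_nonneg _))
      (fun k => by
        rw [norm_mul, ← mul_assoc]
        exact mul_le_mul_of_nonneg_left (hb k)
          (mul_nonneg (Real.rpow_nonneg (knorm_nonneg _) _) (norm_nonneg _)))
      (hc2.mul_right _)
  have key : ∀ (d : (Fin 3 → ℤ) → ℂ), (Summable fun k => ‖d k‖) → ∀ x,
      ∑ i, a i * (∑' k, d k * eK k (x + h i)).re = (∑' k, d k * b k * eK k x).re := by
    intro d hd x
    have : ∑' k, d k * b k * eK k x = ∑ i, (a i : ℂ) * ∑' k, d k * eK k (x + h i) := by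
      simp_rw [← tsum_mul_left]
      rw [← Summable.tsum_finsetSum fun i _ => (summable_mul_eK hd (x + h i)).mul_left _]
      congr 1; funext k
      simp only [b, Finset.mul_sum, Finset.sum_mul]
      refine Finset.sum_congr rfl fun i _ => ?_
      rw [eK_add]; ring
    rw [this, Complex.re_sum]
    refine Finset.sum_congr rfl fun i _ => ?_
    rw [Complex.re_ofReal_mul]
  have hc2' : Summable fun k => ‖((knorm k ^ (2 * γ) : ℝ) : ℂ) * c k‖ := by
    simpa [norm_mul, abs_of_nonneg (Real.rpow_nonneg (knorm_nonneg _) _)] using hc2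
  have hper : Per fun x => (∑' k, c k * b k * eK k x).re := fun x m => by
    simp only [eK_add, eK_int, mul_one]
  obtain ⟨x₀, hx₀⟩ := exists_max_of_per hper (Complex.continuous_re.comp (continuous_tsum_eK hbc))
  have hnn := re_fracSeries_nonneg h0 h1 hbc hbc2 hx₀
  have hM0 := hM x₀
  rw [key c hc]
  refine (hx₀ x).trans ?_
  rw [← key c hc]
  have hsplit : ∑ i, a i * ((∑' k, c k * eK k (x₀ + h i)).re +
        κ * (∑' k, ((knorm k ^ (2 * γ) : ℝ) : ℂ) * c k * eK k (x₀ + h i)).re)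
      = ∑ i, a i * (∑' k, c k * eK k (x₀ + h i)).re
        + κ * ∑ i, a i * (∑' k, ((knorm k ^ (2 * γ) : ℝ) : ℂ) * c k * eK k (x₀ + h i)).re := by
    rw [Finset.mul_sum, ← Finset.sum_add_distrib]
    refine Finset.sum_congr rfl fun i _ => ?_
    ring
  rw [hsplit, key _ hc2'] at hM0
  simp_rw [← mul_assoc] at hnn
  nlinarith [mul_nonneg hκ hnn]

lemma transMax_zero (φ : Sp → ℝ) : TransMax φ fun _ => 0 := by
  intro ι _ a h M hM x
  simpa using hM x

/-- The maximum principle for `φ + κ (-Δ)^γ φ`. -/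
lemma transMax_fracLap {γ κ : ℝ} (h0 : 0 < γ) (h1 : γ ≤ 1) (hκ : 0 ≤ κ) {φ : Sp → ℝ}
    (hp : Per φ) (hc : Continuous φ) : TransMax φ fun x => κ * fracLap γ φ x := by
  by_cases hs : Summable fun k => knorm k ^ (2 * γ) * ‖fCoeff φ k‖
  · have hs1 : Summable fun k => ‖fCoeff φ k‖ := by
      have hs' := hs.add (summable_of_ne_finset_zero (f := fun k : Fin 3 → ℤ => if k = 0 then ‖fCoeff φ k‖ else 0)
        (s := {0}) (fun k hk => if_neg (by simpa using hk)))
      refine Summable.of_nonneg_of_le (fun _ => norm_nonneg _) (fun k => ?_) hs'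
      by_cases hk : k = 0
      · rw [if_pos hk]
        have := mul_nonneg (Real.rpow_nonneg (knorm_nonneg k) (2 * γ)) (norm_nonneg (fCoeff φ k))
        linarith
      · rw [if_neg hk, add_zero]
        exact le_mul_of_one_le_left (norm_nonneg _) (Real.one_le_rpow (one_le_knorm hk) (by linarith))
    have := transMax_of_series h0 h1 hκ hs1 hs
    have e : (fun x => (∑' k, fCoeff φ k * eK k x).re) = φ := by
      funext x
      rw [(hasSum_fCoeff hp hc hs1.of_norm x).tsum_eq, Complex.ofReal_re]
    rw [e] at this
    exact this
  · have : ∀ x, fracLap γ φ x = 0 := by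
      intro x
      unfold fracLap fourierMult
      rw [tsum_eq_zero_of_not_summable, Complex.zero_re]
      intro h
      apply hs
      have := h.norm
      simpa [norm_mul, norm_eK, abs_of_nonneg (Real.rpow_nonneg (knorm_nonneg _) _)] using this
    simp_rw [this, mul_zero]
    exact transMax_zero φ

/-- Passing from a pair to its (uniform) directional derivatives. -/
lemma TransMax.deriv {φ Φ φ' Φ' : Sp → ℝ} (hT : TransMax φ Φ) (e : Sp) {K : ℝ}
    (hφ : ∀ x, ∀ δ ∈ Ioc (0 : ℝ) 1, |φ (x + δ • e) - φ x - δ * φ' x| ≤ K * δ ^ 2)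
    (hΦ : ∀ x, ∀ δ ∈ Ioc (0 : ℝ) 1, |Φ (x + δ • e) - Φ x - δ * Φ' x| ≤ K * δ ^ 2) :
    TransMax φ' Φ' := by
  intro ι _ a h M hM x
  set A := ∑ i, |a i| with hA
  have hK : 0 ≤ K := by
    have := (abs_nonneg _).trans (hφ 0 1 (by simp))
    simpa using this
  have hA0 : 0 ≤ A := Finset.sum_nonneg fun _ _ => abs_nonneg _
  have step : ∀ δ ∈ Ioc (0 : ℝ) 1, ∑ i, a i * φ' (x + h i) ≤ M + 3 * A * K * δ := by
    intro δ hδ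
    have hδ0 : 0 < δ := hδ.1
    have e1 : ∀ y, ∑ i, a i * (φ (y + h i + δ • e) - φ (y + h i)) - δ * ∑ i, a i * φ' (y + h i)
        ∈ Icc (-(A * (K * δ ^ 2))) (A * (K * δ ^ 2)) := by
      intro y
      rw [Set.mem_Icc, ← abs_le, Finset.mul_sum, ← Finset.sum_sub_distrib, hA, Finset.sum_mul]
      refine (Finset.abs_sum_le_sum_abs _ _).trans (Finset.sum_le_sum fun i _ => ?_)
      rw [show a i * (φ (y + h i + δ • e) - φ (y + h i)) - δ * (a i * φ' (y + h i))
        = a i * (φ (y + h i + δ • e) - φ (y + h i) - δ * φ' (y + h i)) by ring, abs_mul]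
      exact mul_le_mul_of_nonneg_left (hφ _ δ hδ) (abs_nonneg _)
    have e2 : ∀ y, ∑ i, a i * (Φ (y + h i + δ • e) - Φ (y + h i)) - δ * ∑ i, a i * Φ' (y + h i)
        ∈ Icc (-(A * (K * δ ^ 2))) (A * (K * δ ^ 2)) := by
      intro y
      rw [Set.mem_Icc, ← abs_le, Finset.mul_sum, ← Finset.sum_sub_distrib, hA, Finset.sum_mul]
      refine (Finset.abs_sum_le_sum_abs _ _).trans (Finset.sum_le_sum fun i _ => ?_)
      rw [show a i * (Φ (y + h i + δ • e) - Φ (y + h i)) - δ * (a i * Φ' (y + h i))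
        = a i * (Φ (y + h i + δ • e) - Φ (y + h i) - δ * Φ' (y + h i)) by ring, abs_mul]
      exact mul_le_mul_of_nonneg_left (hΦ _ δ hδ) (abs_nonneg _)
    have hT' := hT (ι ⊕ ι) (Sum.elim a (fun i => - a i)) (Sum.elim (fun i => h i + δ • e) h)
      (δ * M + 2 * (A * (K * δ ^ 2))) (fun y => by
        simp only [Fintype.sum_sum_type, Sum.elim_inl, Sum.elim_inr, ← add_assoc]
        have h1 := e1 y
        have h2 := e2 y
        have h3 := mul_le_mul_of_nonneg_left (hM y) hδ0.le
        have h4 : ∑ i, a i * (φ (y + h i + δ • e) + Φ (y + h i + δ • e)) +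
            ∑ i, -a i * (φ (y + h i) + Φ (y + h i))
            = ∑ i, a i * (φ (y + h i + δ • e) - φ (y + h i))
              + ∑ i, a i * (Φ (y + h i + δ • e) - Φ (y + h i)) := by
          simp only [← Finset.sum_add_distrib]
          refine Finset.sum_congr rfl fun i _ => ?_
          ring
        have h5 : ∑ i, a i * (φ' (y + h i) + Φ' (y + h i))
            = ∑ i, a i * φ' (y + h i) + ∑ i, a i * Φ' (y + h i) := by
          simp only [← Finset.sum_add_distrib, mul_add]
        rw [h5, mul_add] at h3
        rw [h4]
        linarith [h1.2, h2.2]) x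
    simp only [Fintype.sum_sum_type, Sum.elim_inl, Sum.elim_inr, ← add_assoc] at hT'
    have h4 : ∑ i, a i * φ (x + h i + δ • e) + ∑ i, -a i * φ (x + h i)
        = ∑ i, a i * (φ (x + h i + δ • e) - φ (x + h i)) := by
      simp only [← Finset.sum_add_distrib]
      refine Finset.sum_congr rfl fun i _ => ?_
      ring
    rw [h4] at hT'
    have h1 := (e1 x).1
    have : δ * ∑ i, a i * φ' (x + h i) ≤ δ * (M + 3 * A * K * δ) := by nlinarith
    exact le_of_mul_le_mul_left this hδ0
  have hlim : Tendsto (fun δ : ℝ => M + 3 * A * K * δ) (𝓝[>] 0) (𝓝 (M + 3 * A * K * 0)) :=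
    (Continuous.tendsto (by fun_prop) 0).mono_left nhdsWithin_le_nhds
  rw [mul_zero, add_zero] at hlim
  refine ge_of_tendsto hlim ?_
  filter_upwards [Ioc_mem_nhdsGT (zero_lt_one' ℝ)] with δ hδ using step δ hδ

/-- Iterated spatial derivative of a space-time function in a list of constant directions. -/
def dl {E : Type*} [NormedAddCommGroup E] [NormedSpace ℝ E] : List Sp → (ℝ × Sp → E) → ℝ × Sp → E
  | [], φ => φ
  | e :: l, φ => fun z => fderiv ℝ (dl l φ) z (0, e)

section dl
variable {E : Type*} [NormedAddCommGroup E] [NormedSpace ℝ E]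

lemma contDiff_fderiv_apply_of_smooth {φ : ℝ × Sp → E} (hφ : ContDiff ℝ (⊤ : ℕ∞) φ)
    {w : ℝ × Sp → ℝ × Sp} (hw : ContDiff ℝ (⊤ : ℕ∞) w) :
    ContDiff ℝ (⊤ : ℕ∞) fun z => fderiv ℝ φ z (w z) :=
  (hφ.fderiv_right (m := (⊤ : ℕ∞)) (by simp)).clm_apply hw

lemma contDiff_dl {φ : ℝ × Sp → E} (hφ : ContDiff ℝ (⊤ : ℕ∞) φ) (l : List Sp) :
    ContDiff ℝ (⊤ : ℕ∞) (dl l φ) := by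
  induction l with
  | nil => exact hφ
  | cons e l ih => exact contDiff_fderiv_apply_of_smooth ih contDiff_const

lemma hasFDerivAt_slice {φ : ℝ × Sp → E} {t : ℝ} {x : Sp} (hφ : DifferentiableAt ℝ φ (t, x)) :
    HasFDerivAt (fun y => φ (t, y)) ((fderiv ℝ φ (t, x)).comp (ContinuousLinearMap.inr ℝ ℝ Sp)) x :=
  HasFDerivAt.comp x hφ.hasFDerivAt (hasFDerivAt_prodMk_right t x)

lemma contDiff_slice {φ : ℝ × Sp → E} (hφ : ContDiff ℝ (⊤ : ℕ∞) φ) (t : ℝ) :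
    ContDiff ℝ (⊤ : ℕ∞) fun y => φ (t, y) :=
  hφ.comp (contDiff_const.prodMk contDiff_id)

lemma dl_eq_iteratedFDeriv {φ : ℝ × Sp → E} (hφ : ContDiff ℝ (⊤ : ℕ∞) φ) (l : List Sp) (t : ℝ)
    (x : Sp) : dl l φ (t, x) = iteratedFDeriv ℝ l.length (fun y => φ (t, y)) x l.get := by
  induction l generalizing x with
  | nil => simp [dl]
  | cons e l ih =>
    have hd : DifferentiableAt ℝ (iteratedFDeriv ℝ l.length fun y => φ (t, y)) x :=
      ((contDiff_slice hφ t).differentiable_iteratedFDeriv (m := l.length)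
        (by exact_mod_cast ENat.natCast_lt_top _)) x
    have h1 := (hasFDerivAt_slice (((contDiff_dl hφ l).differentiable (by simp)) (t, x))).fderiv
    have h2 : (fun y => dl l φ (t, y)) = fun y => iteratedFDeriv ℝ l.length (fun y => φ (t, y)) y l.get :=
      funext fun y => ih y
    have h3 : HasFDerivAt (fun y => iteratedFDeriv ℝ l.length (fun y => φ (t, y)) y l.get) _ x :=
      (ContinuousMultilinearMap.apply ℝ (fun _ => Sp) E l.get).hasFDerivAt.comp x hd.hasFDerivAt
    rw [h2, h3.fderiv] at h1
    have h4 := congrArg (fun L => L e) h1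
    simp only [ContinuousLinearMap.comp_apply, ContinuousLinearMap.inr_apply] at h4
    exact h4.symm.trans (iteratedFDeriv_succ_apply_left (n := l.length) (e :: l).get).symm

lemma fderiv_fderiv_apply {φ : ℝ × Sp → E} (hφ : ContDiff ℝ (⊤ : ℕ∞) φ)
    {w : ℝ × Sp → ℝ × Sp} (hw : ContDiff ℝ (⊤ : ℕ∞) w) (z d : ℝ × Sp) :
    fderiv ℝ (fun z => fderiv ℝ φ z (w z)) z d
      = fderiv ℝ (fun z => fderiv ℝ φ z d) z (w z) + fderiv ℝ φ z (fderiv ℝ w z d) := by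
  have hD : DifferentiableAt ℝ (fderiv ℝ φ) z :=
    ((hφ.fderiv_right (m := (⊤ : ℕ∞)) (by simp)).differentiable (by simp)) z
  have hsym : IsSymmSndFDerivAt ℝ φ z :=
    hφ.contDiffAt.isSymmSndFDerivAt (by simpa using WithTop.coe_le_coe.2 (le_top : (2 : ℕ∞) ≤ ⊤))
  rw [(hD.hasFDerivAt.clm_apply (hw.differentiable (by simp) z).hasFDerivAt).fderiv,
    (hD.hasFDerivAt.clm_apply (hasFDerivAt_const d z)).fderiv]
  simp [hsym.eq d (w z), add_comm]

/-- The terms in the commutator of `dl l` with a material derivative. -/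
def commPairs : List Sp → List (List Sp × List Sp)
  | [] => []
  | e :: l => (l, [e]) :: ((commPairs l).map (fun p => (e :: p.1, p.2)) ++
      (commPairs l).map (fun p => (p.1, e :: p.2)))

/-- A single term in the commutator. -/
def commTerm (v : ℝ × Sp → V3) (φ : ℝ × Sp → E) (p : List Sp × List Sp) (z : ℝ × Sp) : E :=
  fderiv ℝ (dl p.1 φ) z (0, dl p.2 v z)

/-- Material derivative on space-time. -/
def mat (v : ℝ × Sp → V3) (φ : ℝ × Sp → E) (z : ℝ × Sp) : E := fderiv ℝ φ z (1, v z)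

lemma contDiff_mat {v : ℝ × Sp → V3} (hv : ContDiff ℝ (⊤ : ℕ∞) v) {φ : ℝ × Sp → E}
    (hφ : ContDiff ℝ (⊤ : ℕ∞) φ) : ContDiff ℝ (⊤ : ℕ∞) (mat v φ) :=
  contDiff_fderiv_apply_of_smooth hφ (contDiff_const.prodMk hv)

lemma contDiff_commTerm {v : ℝ × Sp → V3} (hv : ContDiff ℝ (⊤ : ℕ∞) v) {φ : ℝ × Sp → E}
    (hφ : ContDiff ℝ (⊤ : ℕ∞) φ) (p) : ContDiff ℝ (⊤ : ℕ∞) (commTerm v φ p) :=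
  contDiff_fderiv_apply_of_smooth (contDiff_dl hφ _) (contDiff_const.prodMk (contDiff_dl hv _))

lemma fderiv_list_sum {ι : Type*} (L : List ι) {g : ι → ℝ × Sp → E}
    (hg : ∀ i, Differentiable ℝ (g i)) (z d : ℝ × Sp) :
    fderiv ℝ (fun z => (L.map fun i => g i z).sum) z d = (L.map fun i => fderiv ℝ (g i) z d).sum := by
  have : ∀ L : List ι, Differentiable ℝ (fun z => (L.map fun i => g i z).sum) ∧
      fderiv ℝ (fun z => (L.map fun i => g i z).sum) z d
        = (L.map fun i => fderiv ℝ (g i) z d).sum := by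
    intro L
    induction L with
    | nil => simp
    | cons i L ih =>
      simp only [List.map_cons, List.sum_cons]
      refine ⟨(hg i).add ih.1, ?_⟩
      rw [← ih.2, fderiv_fun_add (hg i z) (ih.1 z)]
      rfl
  exact (this L).2

lemma dl_mat {v : ℝ × Sp → V3} (hv : ContDiff ℝ (⊤ : ℕ∞) v) {φ : ℝ × Sp → E}
    (hφ : ContDiff ℝ (⊤ : ℕ∞) φ) (l : List Sp) :
    dl l (mat v φ) = fun z => mat v (dl l φ) z + ((commPairs l).map fun p => commTerm v φ p z).sum := by
  induction l with
  | nil => funext z; simp [dl, commPairs]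
  | cons e l ih =>
    funext z
    have hsm : ∀ L : List (List Sp × List Sp), Differentiable ℝ fun z => (L.map fun p => commTerm v φ p z).sum := by
      intro L
      induction L with
      | nil => simp
      | cons i L ih =>
        simp only [List.map_cons, List.sum_cons]
        exact ((contDiff_commTerm hv hφ i).differentiable (by simp)).add ih
    change fderiv ℝ (dl l (mat v φ)) z (0, e) = _
    rw [ih, fderiv_fun_add ((contDiff_mat hv (contDiff_dl hφ l)).differentiable (by simp) z) (hsm _ z),
      _root_.add_apply,
      fderiv_list_sum _ fun p => (contDiff_commTerm hv hφ p).differentiable (by simp)]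
    have hder : ∀ (c : ℝ) (b : List Sp), fderiv ℝ (fun z => ((c, dl b v z) : ℝ × Sp)) z (0, e)
        = (0, dl (e :: b) v z) := by
      intro c b
      rw [((hasFDerivAt_const c z).prodMk
        ((contDiff_dl hv b).differentiable (by simp) z).hasFDerivAt).fderiv]
      rfl
    have h1 : fderiv ℝ (mat v (dl l φ)) z (0, e)
        = mat v (dl (e :: l) φ) z + commTerm v φ (l, [e]) z := by
      refine (fderiv_fderiv_apply (contDiff_dl hφ l)
        (contDiff_const.prodMk (contDiff_dl hv []) : ContDiff ℝ (⊤ : ℕ∞) fun z => ((1 : ℝ), dl [] v z)) z (0, e)).trans ?_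
      rw [hder 1 []]
      rfl
    have h2 : ∀ p : List Sp × List Sp, fderiv ℝ (commTerm v φ p) z (0, e)
        = commTerm v φ (e :: p.1, p.2) z + commTerm v φ (p.1, e :: p.2) z := by
      intro p
      refine (fderiv_fderiv_apply (contDiff_dl hφ p.1)
        (contDiff_const.prodMk (contDiff_dl hv p.2) : ContDiff ℝ (⊤ : ℕ∞) fun z => ((0 : ℝ), dl p.2 v z)) z (0, e)).trans ?_
      rw [hder 0 p.2]
      rfl
    rw [h1]
    simp only [h2, commPairs, List.map_cons, List.map_append, List.map_map, List.sum_cons,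
      List.sum_append, List.sum_map_add, Function.comp_def]
    abel

lemma length_commPairs (l : List Sp) : (commPairs l).length ≤ 2 ^ l.length - 1 := by
  induction l with
  | nil => simp [commPairs]
  | cons e l ih =>
    have := Nat.one_le_two_pow (n := l.length)
    simp only [commPairs, List.length_cons, List.length_append, List.length_map, pow_succ]
    omega

lemma mem_commPairs {l : List Sp} {p : List Sp × List Sp} (hp : p ∈ commPairs l) :
    p.1.length + p.2.length = l.length ∧ p.2 ≠ [] ∧ (∀ e ∈ p.1, e ∈ l) ∧ ∀ e ∈ p.2, e ∈ l := by
  induction l generalizing p with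
  | nil => simp [commPairs] at hp
  | cons e l ih =>
    simp only [commPairs, List.mem_cons, List.mem_append, List.mem_map] at hp
    rcases hp with rfl | ⟨q, hq, rfl⟩ | ⟨q, hq, rfl⟩
    · simp +contextual
    · obtain ⟨h1, h2, h3, h4⟩ := ih hq
      refine ⟨by simp; omega, h2, ?_, fun e' he => List.mem_cons_of_mem _ (h4 _ he)⟩
      simp only [List.mem_cons]
      rintro e' (rfl | h)
      · exact Or.inl rfl
      · exact Or.inr (h3 _ h)
    · obtain ⟨h1, h2, h3, h4⟩ := ih hq
      refine ⟨by simp; omega, by simp, fun e' he => List.mem_cons_of_mem _ (h3 _ he), ?_⟩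
      simp only [List.mem_cons]
      rintro e' (rfl | h)
      · exact Or.inl rfl
      · exact Or.inr (h4 _ h)

/-- Spatial periodicity of a space-time function. -/
def PerZ {E : Type*} (φ : ℝ × Sp → E) : Prop :=
  ∀ (z : ℝ × Sp) (k : Fin 3 → ℤ), φ (z + (0, fun i => (k i : ℝ))) = φ z

lemma PerZ.fderiv {φ : ℝ × Sp → E} (h : PerZ φ) : PerZ (fderiv ℝ φ) := by
  intro z k
  rw [← fderiv_comp_add_right]
  congr 1
  funext z
  exact h z k

lemma PerZ.dl {φ : ℝ × Sp → E} (h : PerZ φ) (l : List Sp) : PerZ (dl l φ) := by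
  induction l with
  | nil => exact h
  | cons e l ih =>
    intro z k
    simp only [FNS.dl, ih.fderiv z k]

lemma PerZ.mat {v : ℝ × Sp → V3} (hv : PerZ v) {φ : ℝ × Sp → E} (h : PerZ φ) : PerZ (mat v φ) := by
  intro z k
  simp only [FNS.mat, h.fderiv z k, hv z k]

end dl

lemma PerZ.bounded {E : Type*} [NormedAddCommGroup E] {φ : ℝ × Sp → E} (h : PerZ φ) (hc : Continuous φ) (t0 T : ℝ) :
    ∃ K, 0 ≤ K ∧ ∀ t ∈ Icc t0 T, ∀ x, ‖φ (t, x)‖ ≤ K := by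
  obtain ⟨K, hK⟩ := ((isCompact_Icc (a := t0) (b := T)).prod
    (isCompact_Icc (a := (0 : Sp)) (b := 1))).exists_bound_of_continuousOn hc.continuousOn
  refine ⟨max K 0, le_max_right _ _, fun t ht x => ?_⟩
  have := h (t, fun i => Int.fract (x i)) fun i => ⌊x i⌋
  have e : ((t, fun i => Int.fract (x i)) + (0, fun i => ((⌊x i⌋ : ℤ) : ℝ)) : ℝ × Sp) = (t, x) := by
    ext
    · simp
    · simp
  rw [e] at this
  rw [this]
  exact (hK _ ⟨ht, ⟨fun i => Int.fract_nonneg _, fun i => (Int.fract_lt_one _).le⟩⟩).trans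
    (le_max_left _ _)

/-- First order Taylor expansion, uniformly on a space-time slab. -/
lemma perZ_taylor {E : Type*} [NormedAddCommGroup E] [NormedSpace ℝ E] {φ : ℝ × Sp → E}
    (h : PerZ φ) (hφ : ContDiff ℝ (⊤ : ℕ∞) φ) (t0 T : ℝ) :
    ∃ K, 0 ≤ K ∧ ∀ t ∈ Icc t0 T, ∀ s ∈ Icc t0 T, ∀ x y,
      ‖φ (s, y) - φ (t, x) - fderiv ℝ φ (t, x) (s - t, y - x)‖ ≤ K * ‖((s - t, y - x) : ℝ × Sp)‖ ^ 2 := by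
  have hφ1 := hφ.fderiv_right (m := (⊤ : ℕ∞)) (by simp)
  have hφ2 := hφ1.fderiv_right (m := (⊤ : ℕ∞)) (by simp)
  obtain ⟨K, hK0, hK⟩ := h.fderiv.fderiv.bounded hφ2.continuous t0 T
  refine ⟨K, hK0, fun t ht s hs x y => ?_⟩
  have hconv : Convex ℝ (Icc t0 T ×ˢ (univ : Set Sp)) := (convex_Icc _ _).prod convex_univ
  have hz : ((t, x) : ℝ × Sp) ∈ Icc t0 T ×ˢ (univ : Set Sp) := ⟨ht, mem_univ _⟩
  have hz' : ((s, y) : ℝ × Sp) ∈ Icc t0 T ×ˢ (univ : Set Sp) := ⟨hs, mem_univ _⟩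
  have hseg := hconv.segment_subset hz hz'
  have key := (convex_segment (𝕜 := ℝ) ((t, x) : ℝ × Sp) (s, y)).norm_image_sub_le_of_norm_hasFDerivWithin_le'
    (f := φ) (f' := fderiv ℝ φ) (φ := fderiv ℝ φ (t, x)) (C := K * ‖((s, y) : ℝ × Sp) - (t, x)‖)
    (fun w _ => (hφ.differentiable (by simp) w).hasFDerivAt.hasFDerivWithinAt)
    (fun w hw => by
      refine (hconv.norm_image_sub_le_of_norm_fderiv_le (𝕜 := ℝ)
        (fun w _ => hφ1.differentiable (by simp) w) (fun w hw => hK w.1 hw.1 w.2) hz (hseg hw)).trans ?_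
      refine mul_le_mul_of_nonneg_left ?_ hK0
      obtain ⟨θ, hθ, rfl⟩ := (segment_eq_image' ℝ ((t, x) : ℝ × Sp) (s, y)).subset hw
      rw [add_sub_cancel_left, norm_smul, Real.norm_of_nonneg hθ.1]
      exact mul_le_of_le_one_left (norm_nonneg _) hθ.2)
    (left_mem_segment ℝ _ _) (right_mem_segment ℝ _ _)
  have e : ((s, y) : ℝ × Sp) - (t, x) = (s - t, y - x) := rfl
  rw [e] at key
  rw [pow_two, ← mul_assoc]
  exact key

lemma transMax_dl {φ R : ℝ × Sp → ℝ} (hφ : ContDiff ℝ (⊤ : ℕ∞) φ) (hφp : PerZ φ)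
    (hR : ContDiff ℝ (⊤ : ℕ∞) R) (hRp : PerZ R) {t κ : ℝ}
    (h : TransMax (fun x => φ (t, x)) (fun x => κ * R (t, x))) (l : List Sp) :
    TransMax (fun x => dl l φ (t, x)) (fun x => κ * dl l R (t, x)) := by
  induction l with
  | nil => exact h
  | cons e l ih =>
    obtain ⟨K1, hK1, h1⟩ := perZ_taylor (hφp.dl l) (contDiff_dl hφ l) t t
    obtain ⟨K2, hK2, h2⟩ := perZ_taylor (hRp.dl l) (contDiff_dl hR l) t t
    have ht : t ∈ Icc t t := ⟨le_rfl, le_rfl⟩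
    have hn : ∀ δ : ℝ, ‖((t - t, δ • e) : ℝ × Sp)‖ ^ 2 = ‖e‖ ^ 2 * δ ^ 2 := by
      intro δ
      rw [sub_self, Prod.norm_mk, norm_zero, max_eq_right (norm_nonneg _), norm_smul, mul_pow,
        Real.norm_eq_abs, sq_abs, mul_comm]
    have hs : ∀ (ψ : ℝ × Sp → ℝ) (x : Sp) (δ : ℝ),
        fderiv ℝ ψ (t, x) (t - t, δ • e) = δ * fderiv ℝ ψ (t, x) (0, e) := by
      intro ψ x δ
      rw [← smul_eq_mul, ← map_smul, sub_self, Prod.smul_mk, smul_zero]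
    refine ih.deriv e (K := (K1 + |κ| * K2) * ‖e‖ ^ 2) (fun x δ hδ => ?_) (fun x δ hδ => ?_)
    · have := h1 t ht t ht x (x + δ • e)
      rw [add_sub_cancel_left, hn, hs, Real.norm_eq_abs] at this
      refine this.trans ?_
      have : 0 ≤ |κ| * K2 * (‖e‖ ^ 2 * δ ^ 2) := by positivity
      linarith
    · have := h2 t ht t ht x (x + δ • e)
      rw [add_sub_cancel_left, hn, hs, Real.norm_eq_abs] at this
      have h3 := mul_le_mul_of_nonneg_left this (abs_nonneg κ)
      rw [← abs_mul] at h3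
      rw [show κ * dl l R (t, x + δ • e) - κ * dl l R (t, x) - δ * (κ * dl (e :: l) R (t, x))
        = κ * (dl l R (t, x + δ • e) - dl l R (t, x) - δ * fderiv ℝ (dl l R) (t, x) (0, e)) by
          simp only [dl]; ring]
      refine h3.trans ?_
      have : 0 ≤ K1 * (‖e‖ ^ 2 * δ ^ 2) := by positivity
      linarith

/-- Maximum principle for differences `φ (x + h) - b φ x`. -/
lemma TransMax.abs_le {φ Φ : Sp → ℝ} (hT : TransMax φ Φ) {b M : ℝ} {h : Sp}
    (hM : ∀ x, |(φ (x + h) + Φ (x + h)) - b * (φ x + Φ x)| ≤ M) (x : Sp) :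
    |φ (x + h) - b * φ x| ≤ M := by
  have key : ∀ s : ℝ, |s| = 1 → s * (φ (x + h) - b * φ x) ≤ M := by
    intro s hs
    have := hT Bool (fun i => if i then s else - s * b) (fun i => if i then h else 0) M (fun y => by
      have h1 := (le_abs_self (s * ((φ (y + h) + Φ (y + h)) - b * (φ y + Φ y))))
      rw [abs_mul, hs, one_mul] at h1
      have h2 := h1.trans (hM y)
      simp
      linarith) x
    simp at this
    linarith
  have h1 := key 1 (by simp)
  have h2 := key (-1) (by simp)
  rw [_root_.abs_le]
  constructor <;> linarith

section transport
variable {U R : ℝ × Sp → ℝ} {v : ℝ × Sp → V3} {t0 t1 L α b : ℝ} {g : ℝ → ℝ}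

lemma transport_step (hU : ContDiff ℝ (⊤ : ℕ∞) U) (hUp : PerZ U)
    (hv : ContDiff ℝ (⊤ : ℕ∞) v) (hvp : PerZ v)
    (hT : ∀ t ∈ Ioo t0 t1, ∀ κ, 0 ≤ κ → TransMax (fun x => U (t, x)) (fun x => κ * R (t, x)))
    (hL0 : 0 ≤ L) (hL : ∀ t ∈ Icc t0 t1, ∀ x y, ‖v (t, x) - v (t, y)‖ ≤ L * ‖x - y‖)
    (hα0 : 0 ≤ α) (hg0 : ∀ t ∈ Icc t0 t1, 0 ≤ g t)
    (hg : ∀ t ∈ Icc t0 t1, ∀ x h, |(mat v U (t, x + h) + R (t, x + h)) - b * (mat v U (t, x) + R (t, x))|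
      ≤ g t * ‖h‖ ^ α) {ε : ℝ} (hε : 0 < ε) :
    ∃ K, 0 ≤ K ∧ ∀ s ∈ Icc t0 t1, ∀ t ∈ Ioo t0 t1, s ≤ t → ∀ m, 0 ≤ m →
      (∀ x h, |U (s, x + h) - b * U (s, x)| ≤ m * (ε + ‖h‖ ^ α)) →
      ∀ x h, |U (t, x + h) - b * U (t, x)|
        ≤ (exp (α * L * (t - s)) * m + (t - s) * g t + K * (t - s) ^ 2) * (ε + ‖h‖ ^ α) := by
  obtain ⟨K1, hK1, h1⟩ := perZ_taylor hUp hU t0 t1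
  obtain ⟨V, hV0, hV⟩ := hvp.bounded hv.continuous t0 t1
  set K2 := K1 * (max 1 V) ^ 2 with hK2
  have hK2' : 0 ≤ K2 := by positivity
  refine ⟨(1 + |b|) * K2 / ε, by positivity, fun s hs t ht hst m hm hB x h => ?_⟩
  have ht' := Ioo_subset_Icc_self ht
  set δ := t - s with hδ
  have hδ0 : 0 ≤ δ := sub_nonneg.2 hst
  have tay : ∀ y, |U (s, y - δ • v (t, y)) - U (t, y) + δ * mat v U (t, y)| ≤ K2 * δ ^ 2 := by
    intro y
    have := h1 t ht' s hs y (y - δ • v (t, y))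
    have e : ((s - t, y - δ • v (t, y) - y) : ℝ × Sp) = (-δ) • (1, v (t, y)) := by
      ext
      · simp [hδ]
      · simp
    rw [e, map_smul, norm_smul, norm_neg, Real.norm_of_nonneg hδ0, smul_eq_mul, neg_mul,
      sub_neg_eq_add] at this
    refine this.trans ?_
    rw [mul_pow, hK2, mul_assoc]
    refine mul_le_mul_of_nonneg_left ?_ hK1
    rw [mul_comm]
    refine mul_le_mul_of_nonneg_right ?_ (sq_nonneg _)
    refine pow_le_pow_left₀ (norm_nonneg _) ?_ 2
    rw [Prod.norm_mk, norm_one]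
    exact max_le_max le_rfl (hV t ht' y)
  refine (hT t ht δ hδ0).abs_le (b := b) (h := h) (fun x => ?_) x
  set h' := h - δ • (v (t, x + h) - v (t, x)) with hh'
  have hh1 : ‖h'‖ ≤ (1 + δ * L) * ‖h‖ := by
    have h2 := hL t ht' (x + h) x
    rw [add_sub_cancel_left] at h2
    calc ‖h'‖ ≤ ‖h‖ + ‖δ • (v (t, x + h) - v (t, x))‖ := norm_sub_le _ _
      _ ≤ ‖h‖ + δ * (L * ‖h‖) := by
        rw [norm_smul, Real.norm_of_nonneg hδ0]
        gcongr
      _ = _ := by ring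
  have hexp1 : 1 ≤ exp (α * L * δ) := Real.one_le_exp (by positivity)
  have hW : ε + ‖h'‖ ^ α ≤ exp (α * L * δ) * (ε + ‖h‖ ^ α) := by
    have h3 : ‖h'‖ ^ α ≤ exp (α * L * δ) * ‖h‖ ^ α := by
      calc ‖h'‖ ^ α ≤ (exp (δ * L) * ‖h‖) ^ α := by
            refine Real.rpow_le_rpow (norm_nonneg _) (hh1.trans ?_) hα0
            refine mul_le_mul_of_nonneg_right ?_ (norm_nonneg _)
            linarith [Real.add_one_le_exp (δ * L)]
        _ = _ := by
            rw [Real.mul_rpow (exp_pos _).le (norm_nonneg _), ← Real.exp_mul]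
            ring_nf
    nlinarith
  have hs1 := hB (x - δ • v (t, x)) h'
  have e1 : x - δ • v (t, x) + h' = x + h - δ • v (t, x + h) := by
    rw [hh', smul_sub]; abel
  rw [e1] at hs1
  have t1' := tay (x + h)
  have t2' := tay x
  have hS := hg t ht' x h
  have hp : 0 ≤ ‖h‖ ^ α := Real.rpow_nonneg (norm_nonneg _) _
  have hS2 : |(mat v U (t, x + h) + R (t, x + h)) - b * (mat v U (t, x) + R (t, x))|
      ≤ g t * (ε + ‖h‖ ^ α) :=
    hS.trans (mul_le_mul_of_nonneg_left (by linarith) (hg0 t ht'))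
  set a1 := U (s, x + h - δ • v (t, x + h))
  set a2 := U (s, x - δ • v (t, x))
  set r1 := a1 - U (t, x + h) + δ * mat v U (t, x + h)
  set r2 := a2 - U (t, x) + δ * mat v U (t, x)
  set q := (mat v U (t, x + h) + R (t, x + h)) - b * (mat v U (t, x) + R (t, x))
  have e2 : U (t, x + h) + δ * R (t, x + h) - b * (U (t, x) + δ * R (t, x))
      = (a1 - b * a2) + δ * q - r1 + b * r2 := by
    simp only [q, r1, r2]; ring
  rw [e2]
  have t3 : |b * r2| ≤ |b| * (K2 * δ ^ 2) := by
    rw [abs_mul]; exact mul_le_mul_of_nonneg_left t2' (abs_nonneg _)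
  have t4 : |δ * q| ≤ δ * (g t * (ε + ‖h‖ ^ α)) := by
    rw [abs_mul, abs_of_nonneg hδ0]; exact mul_le_mul_of_nonneg_left hS2 hδ0
  have t5 : |a1 - b * a2| ≤ m * (exp (α * L * δ) * (ε + ‖h‖ ^ α)) :=
    hs1.trans (mul_le_mul_of_nonneg_left hW hm)
  have t6 : (1 + |b|) * (K2 * δ ^ 2) ≤ (1 + |b|) * K2 / ε * δ ^ 2 * (ε + ‖h‖ ^ α) := by
    have : (1 + |b|) * (K2 * δ ^ 2) = (1 + |b|) * K2 / ε * δ ^ 2 * ε := by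
      field_simp
    rw [this]
    exact mul_le_mul_of_nonneg_left (by linarith) (by positivity)
  calc |a1 - b * a2 + δ * q - r1 + b * r2|
      ≤ |a1 - b * a2| + |δ * q| + |r1| + |b * r2| := by
        refine (abs_add_le _ _).trans (add_le_add ((abs_sub _ _).trans
          (add_le_add (abs_add_le _ _) le_rfl)) le_rfl)
    _ ≤ _ := by linarith

/-- The weighted maximum principle for the advection-diffusion equation. -/
lemma transport_bound (h01 : t0 ≤ t1) (hU : ContDiff ℝ (⊤ : ℕ∞) U) (hUp : PerZ U)
    (hv : ContDiff ℝ (⊤ : ℕ∞) v) (hvp : PerZ v)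
    (hT : ∀ t ∈ Ioo t0 t1, ∀ κ, 0 ≤ κ → TransMax (fun x => U (t, x)) (fun x => κ * R (t, x)))
    (hL0 : 0 ≤ L) (hL : ∀ t ∈ Icc t0 t1, ∀ x y, ‖v (t, x) - v (t, y)‖ ≤ L * ‖x - y‖)
    (hα0 : 0 ≤ α) (hg0 : ∀ t ∈ Icc t0 t1, 0 ≤ g t) (hgc : ContinuousOn g (Icc t0 t1))
    (hg : ∀ t ∈ Icc t0 t1, ∀ x h, |(mat v U (t, x + h) + R (t, x + h)) - b * (mat v U (t, x) + R (t, x))|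
      ≤ g t * ‖h‖ ^ α) {m0 : ℝ} (hm0 : 0 ≤ m0)
    (h0 : ∀ x h, |U (t0, x + h) - b * U (t0, x)| ≤ m0 * ‖h‖ ^ α) (x h : Sp) :
    |U (t1, x + h) - b * U (t1, x)|
      ≤ exp (α * L * (t1 - t0)) * (m0 + ∫ τ in t0..t1, g τ) * ‖h‖ ^ α := by
  rcases h01.eq_or_lt with rfl | h01'
  · simpa using h0 x h
  have hint : ∀ s ∈ Icc t0 t1, ∀ t ∈ Icc t0 t1, IntervalIntegrable g volume s t := fun s hs t ht =>
    (hgc.mono (uIcc_subset_Icc hs ht)).intervalIntegrable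
  have hintnn : ∀ s ∈ Icc t0 t1, ∀ t ∈ Icc t0 t1, s ≤ t → 0 ≤ ∫ τ in s..t, g τ :=
    fun s hs t ht hst => intervalIntegral.integral_nonneg hst fun u hu =>
      hg0 u ⟨hs.1.trans hu.1, hu.2.trans ht.2⟩
  have ht0 : t0 ∈ Icc t0 t1 := ⟨le_rfl, h01⟩
  have ht1 : t1 ∈ Icc t0 t1 := ⟨h01, le_rfl⟩
  have main : ∀ ε, 0 < ε → |U (t1, x + h) - b * U (t1, x)|
      ≤ exp (α * L * (t1 - t0)) * (m0 + (∫ τ in t0..t1, g τ) + ε * (t1 - t0)) * (ε + ‖h‖ ^ α) := by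
    intro ε hε
    obtain ⟨K, hK0, hK⟩ := transport_step hU hUp hv hvp hT hL0 hL hα0 hg0 hg hε
    let F : ℝ → ℝ := fun t => exp (α * L * (t - t0)) * (m0 + (∫ τ in t0..t, g τ) + ε * (t - t0))
    have hF0 : ∀ t ∈ Icc t0 t1, 0 ≤ F t := fun t ht => by
      have := hintnn t0 ht0 t ht ht.1
      have := sub_nonneg.2 ht.1
      positivity
    obtain ⟨d, hd0, hd⟩ := Metric.uniformContinuousOn_iff.1
      (isCompact_Icc.uniformContinuousOn_of_continuous hgc) (ε / 2) (by positivity)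
    set δ0 := min (d / 2) (ε / (2 * (K + 1))) with hδ0
    have hδ0' : 0 < δ0 := lt_min (by positivity) (by positivity)
    have claim : ∀ n : ℕ, ∀ t ∈ Ico t0 t1, t - t0 ≤ n * δ0 →
        ∀ x h, |U (t, x + h) - b * U (t, x)| ≤ F t * (ε + ‖h‖ ^ α) := by
      have base : ∀ x h, |U (t0, x + h) - b * U (t0, x)| ≤ F t0 * (ε + ‖h‖ ^ α) := by
        intro x h
        refine (h0 x h).trans ?_
        simp only [F, sub_self, mul_zero, exp_zero, intervalIntegral.integral_same, add_zero, one_mul]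
        exact mul_le_mul_of_nonneg_left (by linarith) hm0
      intro n
      induction n with
      | zero =>
        intro t ht hn
        have : t = t0 := le_antisymm (by simpa using hn) ht.1
        rw [this]
        exact base
      | succ n ih =>
        intro t ht hn x h
        rcases ht.1.eq_or_lt with rfl | htt
        · exact base x h
        set s := max t0 (t - δ0) with hs
        have hst : s ≤ t := max_le ht.1 (by linarith)
        have hsI : s ∈ Icc t0 t1 := ⟨le_max_left _ _, hst.trans ht.2.le⟩
        have htI : t ∈ Icc t0 t1 := ⟨ht.1, ht.2.le⟩
        have hδ : t - s ≤ δ0 := by linarith [le_max_right t0 (t - δ0)]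
        have hB := ih s ⟨hsI.1, hst.trans_lt ht.2⟩ (by
          rw [sub_le_iff_le_add]
          refine max_le ?_ ?_
          · have : 0 ≤ (n : ℝ) * δ0 := by positivity
            linarith
          · push_cast at hn; linarith)
        refine (hK s hsI t ⟨htt, ht.2⟩ hst (F s) (hF0 s hsI) hB x h).trans ?_
        refine mul_le_mul_of_nonneg_right ?_ (by positivity)
        have hi1 : (∫ τ in t0..t, g τ) = (∫ τ in t0..s, g τ) + ∫ τ in s..t, g τ :=
          (intervalIntegral.integral_add_adjacent_intervals (hint _ ht0 _ hsI) (hint _ hsI _ htI)).symm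
        have hi2 : (t - s) * (g t - ε / 2) ≤ ∫ τ in s..t, g τ := by
          rw [← smul_eq_mul, ← intervalIntegral.integral_const]
          refine intervalIntegral.integral_mono_on hst (by simp) (hint _ hsI _ htI) fun u hu => ?_
          have := hd t htI u ⟨hsI.1.trans hu.1, hu.2.trans htI.2⟩ (by
            rw [Real.dist_eq, abs_of_nonneg (by linarith [hu.2])]
            have := min_le_left (d / 2) (ε / (2 * (K + 1)))
            linarith [hu.1])
          rw [Real.dist_eq] at this
          linarith [(_root_.abs_lt.1 this).2]
        have hexp : exp (α * L * (t - t0)) = exp (α * L * (t - s)) * exp (α * L * (s - t0)) := by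
          rw [← Real.exp_add]; ring_nf
        have hts : 0 ≤ t - s := sub_nonneg.2 hst
        have hone : 1 ≤ exp (α * L * (t - t0)) :=
          Real.one_le_exp (mul_nonneg (mul_nonneg hα0 hL0) (sub_nonneg.2 ht.1))
        have hI := hintnn s hsI t htI hst
        have hF : F t = exp (α * L * (t - s)) * F s
            + exp (α * L * (t - t0)) * ((∫ τ in s..t, g τ) + ε * (t - s)) := by
          simp only [F]
          rw [hi1, hexp]; ring
        have hk : K * (t - s) ^ 2 ≤ (t - s) * (ε / 2) := by
          have h1 : (t - s) ≤ ε / (2 * (K + 1)) := hδ.trans (min_le_right _ _)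
          rw [le_div_iff₀ (by positivity)] at h1
          nlinarith
        rw [hF]
        have : (∫ τ in s..t, g τ) + ε * (t - s)
            ≤ exp (α * L * (t - t0)) * ((∫ τ in s..t, g τ) + ε * (t - s)) :=
          le_mul_of_one_le_left (by positivity) hone
        linarith
    have hF1 : ∀ t ∈ Ico t0 t1, |U (t, x + h) - b * U (t, x)| ≤ F t1 * (ε + ‖h‖ ^ α) := by
      intro t ht
      obtain ⟨n, hn⟩ := exists_nat_ge ((t - t0) / δ0)
      refine (claim n t ht (by rwa [div_le_iff₀ hδ0'] at hn) x h).trans ?_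
      refine mul_le_mul_of_nonneg_right ?_ (by positivity)
      have htI : t ∈ Icc t0 t1 := ⟨ht.1, ht.2.le⟩
      have hi1 : (∫ τ in t0..t1, g τ) = (∫ τ in t0..t, g τ) + ∫ τ in t..t1, g τ :=
        (intervalIntegral.integral_add_adjacent_intervals (hint _ ht0 _ htI) (hint _ htI _ ht1)).symm
      have := hintnn t htI t1 ht1 ht.2.le
      have := hintnn t0 ht0 t htI ht.1
      have htt := sub_nonneg.2 ht.1
      have ht2 := ht.2
      simp only [F]
      gcongr
      · linarith
    have hcont : Continuous fun t => |U (t, x + h) - b * U (t, x)| := by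
      have := hU.continuous
      fun_prop
    refine le_of_tendsto (hcont.continuousWithinAt (s := Iio t1) (x := t1)) ?_
    filter_upwards [Ico_mem_nhdsLT h01'] with t ht using hF1 t ht
  have hlim : Tendsto (fun ε : ℝ => exp (α * L * (t1 - t0)) *
      (m0 + (∫ τ in t0..t1, g τ) + ε * (t1 - t0)) * (ε + ‖h‖ ^ α)) (𝓝[>] 0)
      (𝓝 (exp (α * L * (t1 - t0)) *
      (m0 + (∫ τ in t0..t1, g τ) + 0 * (t1 - t0)) * (0 + ‖h‖ ^ α))) :=
    (Continuous.tendsto (by fun_prop) 0).mono_left nhdsWithin_le_nhds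
  rw [zero_mul, add_zero, zero_add] at hlim
  refine ge_of_tendsto hlim ?_
  filter_upwards [self_mem_nhdsWithin] with ε hε using main ε hε

end transport

section lip
variable {E : Type*} [NormedAddCommGroup E] [NormedSpace ℝ E]

lemma perZ_lip {φ : ℝ × Sp → E} (h : PerZ φ) (hφ : ContDiff ℝ (⊤ : ℕ∞) φ) (t0 T : ℝ) :
    ∃ K, 0 ≤ K ∧ ∀ t ∈ Icc t0 T, ∀ s ∈ Icc t0 T, ∀ x y,
      ‖φ (t, x) - φ (s, y)‖ ≤ K * ‖((t - s, x - y) : ℝ × Sp)‖ := by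
  have hφ1 := hφ.fderiv_right (m := (⊤ : ℕ∞)) (by simp)
  obtain ⟨K, hK0, hK⟩ := h.fderiv.bounded hφ1.continuous t0 T
  refine ⟨K, hK0, fun t ht s hs x y => ?_⟩
  have hconv : Convex ℝ (Icc t0 T ×ˢ (univ : Set Sp)) := (convex_Icc _ _).prod convex_univ
  exact hconv.norm_image_sub_le_of_norm_fderiv_le (𝕜 := ℝ) (f := φ)
    (fun w _ => hφ.differentiable (by simp) w) (fun w hw => hK w.1 hw.1 w.2)
    (show ((s, y) : ℝ × Sp) ∈ _ from ⟨hs, mem_univ _⟩)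
    (show ((t, x) : ℝ × Sp) ∈ _ from ⟨ht, mem_univ _⟩)

lemma le_rpow_of_le_of_le {A K r α : ℝ} (hr : 0 ≤ r) (hα0 : 0 ≤ α) (hα1 : α ≤ 1)
    (hK : 0 ≤ K) (h1 : A ≤ K) (h2 : A ≤ K * r) : A ≤ K * r ^ α := by
  rcases le_total r 1 with h | h
  · rcases hr.eq_or_lt with rfl | hr'
    · have : 0 ≤ (0 : ℝ) ^ α := Real.rpow_nonneg le_rfl _
      nlinarith
    · refine h2.trans (mul_le_mul_of_nonneg_left ?_ hK)
      have := Real.rpow_le_rpow_of_exponent_ge hr' h hα1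
      rwa [Real.rpow_one] at this
  · exact h1.trans (le_mul_of_one_le_right hK (Real.one_le_rpow h hα0))

lemma perZ_holder {φ : ℝ × Sp → E} (h : PerZ φ) (hφ : ContDiff ℝ (⊤ : ℕ∞) φ) (t0 T : ℝ) :
    ∃ K, 0 ≤ K ∧ ∀ α : ℝ, 0 ≤ α → α ≤ 1 → ∀ t ∈ Icc t0 T, ∀ x y,
      ‖φ (t, x) - φ (t, y)‖ ≤ K * ‖x - y‖ ^ α := by
  obtain ⟨K, hK0, hK⟩ := h.bounded hφ.continuous t0 T
  obtain ⟨K1, hK10, hK1⟩ := perZ_lip h hφ t0 T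
  refine ⟨2 * K + K1, by positivity, ?_⟩
  intro α hα0 hα1 t ht x y
  apply le_rpow_of_le_of_le (norm_nonneg (x - y)) hα0 hα1 (by positivity)
  · linarith [norm_sub_le (φ (t, x)) (φ (t, y)), hK t ht x, hK t ht y]
  · refine (hK1 t ht t ht x y).trans ?_
    rw [sub_self, Prod.norm_mk, norm_zero, max_eq_right (norm_nonneg _)]
    exact mul_le_mul_of_nonneg_right (by linarith) (norm_nonneg _)

lemma perZ_lip_holder {φ : ℝ × Sp → E} (h : PerZ φ) (hφ : ContDiff ℝ (⊤ : ℕ∞) φ) (t0 T : ℝ) :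
    ∃ K, 0 ≤ K ∧ ∀ α : ℝ, 0 ≤ α → α ≤ 1 → ∀ t ∈ Icc t0 T, ∀ s ∈ Icc t0 T, ∀ x y,
      ‖(φ (t, x) - φ (t, y)) - (φ (s, x) - φ (s, y))‖ ≤ K * ‖x - y‖ ^ α * |t - s| := by
  obtain ⟨K, hK0, hK⟩ := perZ_holder h.fderiv (hφ.fderiv_right (m := (⊤ : ℕ∞)) (by simp)) t0 T
  refine ⟨K, hK0, fun α hα0 hα1 t ht s hs x y => ?_⟩
  have hd : ∀ x τ, HasDerivAt (fun τ => φ (τ, x)) (fderiv ℝ φ (τ, x) (1, 0)) τ := by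
    intro x τ
    have := (hφ.differentiable (by simp) (τ, x)).hasFDerivAt.comp_hasDerivAt τ
      ((hasDerivAt_id τ).prodMk (hasDerivAt_const τ x))
    exact this
  rw [← Real.norm_eq_abs]
  refine (convex_Icc t0 T).norm_image_sub_le_of_norm_hasDerivWithin_le
    (f := fun τ => φ (τ, x) - φ (τ, y))
    (fun τ _ => ((hd x τ).sub (hd y τ)).hasDerivWithinAt) (fun τ hτ => ?_) hs ht
  rw [← sub_apply]
  refine ((fderiv ℝ φ (τ, x) - fderiv ℝ φ (τ, y)).le_opNorm _).trans ?_
  have : ‖((1, 0) : ℝ × Sp)‖ = 1 := by simp [Prod.norm_mk]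
  rw [this, mul_one]
  exact hK α hα0 hα1 τ hτ x y

lemma PerZ.iteratedFDeriv {φ : ℝ × Sp → E} (h : PerZ φ) (N : ℕ) :
    PerZ (iteratedFDeriv ℝ N φ) := by
  intro z k
  rw [← iteratedFDeriv_comp_add_right]
  congr 1
  funext z
  exact h z k

/-- Restricting the full jet of a space-time function to space directions. -/
lemma iteratedFDeriv_slice {φ : ℝ × Sp → E} (hφ : ContDiff ℝ (⊤ : ℕ∞) φ) (N : ℕ) (t : ℝ) (x : Sp) :
    iteratedFDeriv ℝ N (fun y => φ (t, y)) x
      = (iteratedFDeriv ℝ N φ (t, x)).compContinuousLinearMap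
        fun _ => ContinuousLinearMap.inr ℝ ℝ Sp := by
  have h1 : (fun y => φ (t, y)) = (fun z => φ ((t, 0) + z)) ∘ ContinuousLinearMap.inr ℝ ℝ Sp := by
    funext y
    simp
  rw [h1, ContinuousLinearMap.iteratedFDeriv_comp_right (n := (⊤ : ℕ∞)) _
    (f := fun z => φ ((t, 0) + z)) (hφ.comp (contDiff_const.add contDiff_id)) x (by exact_mod_cast le_top),
    iteratedFDeriv_comp_add_left]
  simp

lemma norm_compInr_le {N : ℕ} (A : ContinuousMultilinearMap ℝ (fun _ : Fin N => ℝ × Sp) E) :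
    ‖A.compContinuousLinearMap fun _ => ContinuousLinearMap.inr ℝ ℝ Sp‖ ≤ ‖A‖ := by
  refine (ContinuousMultilinearMap.norm_compContinuousLinearMap_le _ _).trans ?_
  refine mul_le_of_le_one_right (norm_nonneg _) (Finset.prod_le_one (fun _ _ => norm_nonneg _)
    fun _ _ => ContinuousLinearMap.opNorm_le_bound _ zero_le_one fun x => ?_)
  simp [Prod.norm_mk]

lemma compInr_sub {N : ℕ} (A B : ContinuousMultilinearMap ℝ (fun _ : Fin N => ℝ × Sp) E) :
    (A.compContinuousLinearMap fun _ => ContinuousLinearMap.inr ℝ ℝ Sp)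
      - (B.compContinuousLinearMap fun _ => ContinuousLinearMap.inr ℝ ℝ Sp)
      = (A - B).compContinuousLinearMap fun _ => ContinuousLinearMap.inr ℝ ℝ Sp := by
  ext; simp

lemma contDiff_iteratedFDeriv_smooth {φ : ℝ × Sp → E} (hφ : ContDiff ℝ (⊤ : ℕ∞) φ) (N : ℕ) :
    ContDiff ℝ (⊤ : ℕ∞) (iteratedFDeriv ℝ N φ) :=
  hφ.iteratedFDeriv_right (m := (⊤ : ℕ∞)) (i := N) (by exact_mod_cast le_top)

lemma slice_bounded {φ : ℝ × Sp → E} (h : PerZ φ) (hφ : ContDiff ℝ (⊤ : ℕ∞) φ) (N : ℕ) (t0 T : ℝ) :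
    ∃ K, 0 ≤ K ∧ ∀ t ∈ Icc t0 T, ∀ x, ‖iteratedFDeriv ℝ N (fun y => φ (t, y)) x‖ ≤ K := by
  obtain ⟨K, hK0, hK⟩ := (h.iteratedFDeriv N).bounded (contDiff_iteratedFDeriv_smooth hφ N).continuous t0 T
  refine ⟨K, hK0, fun t ht x => ?_⟩
  rw [iteratedFDeriv_slice hφ]
  exact (norm_compInr_le _).trans (hK t ht x)

lemma slice_lip {φ : ℝ × Sp → E} (h : PerZ φ) (hφ : ContDiff ℝ (⊤ : ℕ∞) φ) (N : ℕ) (t0 T : ℝ) :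
    ∃ K, 0 ≤ K ∧ ∀ t ∈ Icc t0 T, ∀ s ∈ Icc t0 T, ∀ x, ‖iteratedFDeriv ℝ N (fun y => φ (t, y)) x
      - iteratedFDeriv ℝ N (fun y => φ (s, y)) x‖ ≤ K * |t - s| := by
  obtain ⟨K, hK0, hK⟩ := perZ_lip (h.iteratedFDeriv N) (contDiff_iteratedFDeriv_smooth hφ N) t0 T
  refine ⟨K, hK0, fun t ht s hs x => ?_⟩
  rw [iteratedFDeriv_slice hφ, iteratedFDeriv_slice hφ, compInr_sub]
  refine (norm_compInr_le _).trans ((hK t ht s hs x x).trans ?_)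
  rw [sub_self, Prod.norm_mk, norm_zero, max_eq_left (norm_nonneg _), Real.norm_eq_abs]

lemma slice_holder {φ : ℝ × Sp → E} (h : PerZ φ) (hφ : ContDiff ℝ (⊤ : ℕ∞) φ) (N : ℕ) (t0 T : ℝ) :
    ∃ K, 0 ≤ K ∧ ∀ α : ℝ, 0 ≤ α → α ≤ 1 → ∀ t ∈ Icc t0 T, ∀ x y,
      ‖iteratedFDeriv ℝ N (fun y => φ (t, y)) x - iteratedFDeriv ℝ N (fun y => φ (t, y)) y‖
        ≤ K * ‖x - y‖ ^ α := by
  obtain ⟨K, hK0, hK⟩ := perZ_holder (h.iteratedFDeriv N) (contDiff_iteratedFDeriv_smooth hφ N) t0 T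
  refine ⟨K, hK0, fun α hα0 hα1 t ht x y => ?_⟩
  rw [iteratedFDeriv_slice hφ, iteratedFDeriv_slice hφ, compInr_sub]
  exact (norm_compInr_le _).trans (hK α hα0 hα1 t ht x y)

lemma slice_lip_holder {φ : ℝ × Sp → E} (h : PerZ φ) (hφ : ContDiff ℝ (⊤ : ℕ∞) φ) (N : ℕ) (t0 T : ℝ) :
    ∃ K, 0 ≤ K ∧ ∀ α : ℝ, 0 ≤ α → α ≤ 1 → ∀ t ∈ Icc t0 T, ∀ s ∈ Icc t0 T, ∀ x y,
      ‖(iteratedFDeriv ℝ N (fun y => φ (t, y)) x - iteratedFDeriv ℝ N (fun y => φ (t, y)) y)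
        - (iteratedFDeriv ℝ N (fun y => φ (s, y)) x - iteratedFDeriv ℝ N (fun y => φ (s, y)) y)‖
        ≤ K * ‖x - y‖ ^ α * |t - s| := by
  obtain ⟨K, hK0, hK⟩ := perZ_lip_holder (h.iteratedFDeriv N) (contDiff_iteratedFDeriv_smooth hφ N) t0 T
  refine ⟨K, hK0, fun α hα0 hα1 t ht s hs x y => ?_⟩
  simp only [iteratedFDeriv_slice hφ, compInr_sub]
  exact (norm_compInr_le _).trans (hK α hα0 hα1 t ht s hs x y)

lemma continuousOn_iSup_of_lip {ι : Type*} [Nonempty ι] {q : ι → ℝ → ℝ} {K K' : ℝ} {I : Set ℝ}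
    (hb : ∀ t ∈ I, ∀ i, q i t ≤ K') (hl : ∀ t ∈ I, ∀ s ∈ I, ∀ i, q i t - q i s ≤ K * |t - s|) :
    ContinuousOn (fun t => ⨆ i, q i t) I := by
  have hK : ∀ t ∈ I, ∀ s ∈ I, (⨆ i, q i t) - (⨆ i, q i s) ≤ K * |t - s| := by
    intro t ht s hs
    rw [sub_le_iff_le_add]
    refine ciSup_le fun i => ?_
    have h1 := hl t ht s hs i
    have h2 := le_ciSup (f := fun i => q i s) ⟨K', by rintro _ ⟨i, rfl⟩; exact hb s hs i⟩ i
    linarith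
  refine LipschitzOnWith.continuousOn (K := K.toNNReal) (LipschitzOnWith.of_dist_le_mul fun t ht s hs => ?_)
  rw [Real.dist_eq, Real.dist_eq, _root_.abs_le]
  have h3 : K * |t - s| ≤ K.toNNReal * |t - s| :=
    mul_le_mul_of_nonneg_right (Real.le_coe_toNNReal K) (abs_nonneg _)
  constructor
  · have := hK s hs t ht
    rw [abs_sub_comm] at this
    linarith
  · exact (hK t ht s hs).trans h3

end lip

lemma PerT.perZ {E : Type*} {f : ℝ → Sp → E} (hp : PerT f) : PerZ fun p : ℝ × Sp => f p.1 p.2 := by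
  intro z k
  simpa using hp z.1 z.2 k

lemma C0_nonneg {E : Type*} [NormedAddCommGroup E] (f : Sp → E) : 0 ≤ C0 f := Real.iSup_nonneg fun _ => norm_nonneg _

section seminorms
variable {E : Type*} [NormedAddCommGroup E] [NormedSpace ℝ E]

instance : Nonempty {p : Sp × Sp // p.1 ≠ p.2} := ⟨⟨(0, 1), zero_ne_one⟩⟩

lemma norm_le_semN {f : ℝ → Sp → E} (hf : SmoothST f) (hp : PerT f) (N : ℕ) (t : ℝ) (x : Sp) :
    ‖iteratedFDeriv ℝ N (f t) x‖ ≤ semN N (f t) := by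
  obtain ⟨K, -, hK⟩ := slice_bounded hp.perZ hf N t t
  exact le_ciSup (f := fun x => ‖iteratedFDeriv ℝ N (f t) x‖)
    ⟨K, by rintro _ ⟨x, rfl⟩; exact hK t ⟨le_rfl, le_rfl⟩ x⟩ x

lemma norm_le_C0 {f : ℝ → Sp → E} (hf : SmoothST f) (hp : PerT f) (t : ℝ) (x : Sp) :
    ‖f t x‖ ≤ C0 (f t) := by
  obtain ⟨K, -, hK⟩ := hp.perZ.bounded hf.continuous t t
  exact le_ciSup (f := fun x => ‖f t x‖)
    ⟨K, by rintro _ ⟨x, rfl⟩; exact hK t ⟨le_rfl, le_rfl⟩ x⟩ x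

lemma semN_nonneg (N : ℕ) (f : Sp → E) : 0 ≤ semN N f := Real.iSup_nonneg fun _ => norm_nonneg _

lemma semH_nonneg (N : ℕ) (α : ℝ) (f : Sp → E) : 0 ≤ semH N α f :=
  Real.iSup_nonneg fun _ => div_nonneg (norm_nonneg _) (Real.rpow_nonneg (norm_nonneg _) _)

lemma semH_le {N : ℕ} {α c : ℝ} {f : Sp → E}
    (h : ∀ x y, ‖iteratedFDeriv ℝ N f x - iteratedFDeriv ℝ N f y‖ ≤ c * ‖x - y‖ ^ α) :
    semH N α f ≤ c :=
  ciSup_le fun p => by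
    have : 0 < ‖p.val.1 - p.val.2‖ := norm_pos_iff.2 (sub_ne_zero.2 p.2)
    rw [div_le_iff₀ (Real.rpow_pos_of_pos this _)]
    exact h _ _

lemma holderQuot_le {A c r α : ℝ} (hc : 0 ≤ c) (hr : 0 ≤ r) (h : A ≤ c * r ^ α) :
    A / r ^ α ≤ c := by
  rcases (Real.rpow_nonneg hr α).eq_or_lt with h0 | h0
  · rw [← h0, div_zero]; exact hc
  · rwa [div_le_iff₀ h0]

lemma le_semH {f : ℝ → Sp → E} (hf : SmoothST f) (hp : PerT f) (N : ℕ) {α : ℝ} (hα0 : 0 ≤ α)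
    (hα1 : α ≤ 1) (t : ℝ) (x y : Sp) :
    ‖iteratedFDeriv ℝ N (f t) x - iteratedFDeriv ℝ N (f t) y‖ ≤ semH N α (f t) * ‖x - y‖ ^ α := by
  by_cases hxy : x = y
  · rw [hxy, sub_self, norm_zero]
    exact mul_nonneg (semH_nonneg _ _ _) (Real.rpow_nonneg (norm_nonneg _) _)
  obtain ⟨K, hK0, hK⟩ := slice_holder hp.perZ hf N t t
  have : 0 < ‖x - y‖ := norm_pos_iff.2 (sub_ne_zero.2 hxy)
  rw [← div_le_iff₀ (Real.rpow_pos_of_pos this _)]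
  refine le_ciSup (f := fun p : {p : Sp × Sp // p.1 ≠ p.2} =>
    ‖iteratedFDeriv ℝ N (f t) p.val.1 - iteratedFDeriv ℝ N (f t) p.val.2‖ / ‖p.val.1 - p.val.2‖ ^ α)
    ⟨K, ?_⟩ ⟨(x, y), hxy⟩
  rintro _ ⟨p, rfl⟩
  exact holderQuot_le hK0 (norm_nonneg _) (hK α hα0 hα1 t ⟨le_rfl, le_rfl⟩ _ _)

lemma continuousOn_semN {f : ℝ → Sp → E} (hf : SmoothST f) (hp : PerT f) (N : ℕ) (t0 T : ℝ) :
    ContinuousOn (fun t => semN N (f t)) (Icc t0 T) := by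
  obtain ⟨K, hK0, hK⟩ := slice_bounded hp.perZ hf N t0 T
  obtain ⟨K', hK0', hK'⟩ := slice_lip hp.perZ hf N t0 T
  exact continuousOn_iSup_of_lip (q := fun x t => ‖iteratedFDeriv ℝ N (f t) x‖) hK
    fun t ht s hs x => (norm_sub_norm_le _ _).trans (hK' t ht s hs x)

lemma continuousOn_C0 {f : ℝ → Sp → E} (hf : SmoothST f) (hp : PerT f) (t0 T : ℝ) :
    ContinuousOn (fun t => C0 (f t)) (Icc t0 T) := by
  obtain ⟨K, hK0, hK⟩ := hp.perZ.bounded hf.continuous t0 T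
  obtain ⟨K', hK0', hK'⟩ := perZ_lip hp.perZ hf t0 T
  refine continuousOn_iSup_of_lip (K := K') (q := fun x t => ‖f t x‖) hK
    fun t ht s hs x => (norm_sub_norm_le _ _).trans ((hK' t ht s hs x x).trans ?_)
  rw [sub_self, Prod.norm_mk, norm_zero, max_eq_left (norm_nonneg _), Real.norm_eq_abs]

lemma continuousOn_semH {f : ℝ → Sp → E} (hf : SmoothST f) (hp : PerT f) (N : ℕ) {α : ℝ}
    (hα0 : 0 ≤ α) (hα1 : α ≤ 1) (t0 T : ℝ) :
    ContinuousOn (fun t => semH N α (f t)) (Icc t0 T) := by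
  obtain ⟨K, hK0, hK⟩ := slice_holder hp.perZ hf N t0 T
  obtain ⟨K', hK0', hK'⟩ := slice_lip_holder hp.perZ hf N t0 T
  refine continuousOn_iSup_of_lip (K := K') (q := fun (p : {p : Sp × Sp // p.1 ≠ p.2}) t =>
    ‖iteratedFDeriv ℝ N (f t) p.val.1 - iteratedFDeriv ℝ N (f t) p.val.2‖ / ‖p.val.1 - p.val.2‖ ^ α)
    (fun t ht p => holderQuot_le hK0 (norm_nonneg _) (hK α hα0 hα1 t ht _ _))
    fun t ht s hs p => ?_
  rw [← sub_div]
  refine holderQuot_le (by positivity) (norm_nonneg _) ?_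
  refine (norm_sub_norm_le _ _).trans ((hK' α hα0 hα1 t ht s hs _ _).trans (le_of_eq ?_))
  ring

lemma le_biSup_of_bounded {q : ℝ → ℝ} {I : Set ℝ} {K : ℝ} (hK : ∀ t ∈ I, q t ≤ K) {t : ℝ} (ht : t ∈ I) :
    q t ≤ ⨆ t ∈ I, q t := by
  have : BddAbove (range fun t => ⨆ _ : t ∈ I, q t) := by
    refine ⟨max K 0, ?_⟩
    rintro _ ⟨s, rfl⟩
    by_cases hs : s ∈ I
    · simp only [hs, ciSup_unique]
      exact (hK s hs).trans (le_max_left _ _)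
    · simp only [hs, Real.iSup_of_isEmpty]
      exact le_max_right _ _
  refine le_trans ?_ (le_ciSup this t)
  simp [ht]

lemma semN_le_semNT {f : ℝ → Sp → E} (hf : SmoothST f) (hp : PerT f) (N : ℕ) {t0 T t : ℝ}
    (ht : t ∈ Icc t0 T) : semN N (f t) ≤ semNT N f t0 T := by
  obtain ⟨K, hK0, hK⟩ := slice_bounded hp.perZ hf N t0 T
  exact le_biSup_of_bounded (q := fun t => semN N (f t)) (fun t ht => ciSup_le (hK t ht)) ht

lemma semH_le_semHT {f : ℝ → Sp → E} (hf : SmoothST f) (hp : PerT f) (N : ℕ) {α : ℝ}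
    (hα0 : 0 ≤ α) (hα1 : α ≤ 1) {t0 T t : ℝ}
    (ht : t ∈ Icc t0 T) : semH N α (f t) ≤ semHT N α f t0 T := by
  obtain ⟨K, hK0, hK⟩ := slice_holder hp.perZ hf N t0 T
  exact le_biSup_of_bounded (q := fun t => semH N α (f t))
    (fun t ht => semH_le (hK α hα0 hα1 t ht)) ht

lemma lipschitz_iteratedFDeriv {f : ℝ → Sp → E} (hf : SmoothST f) (hp : PerT f) (N : ℕ) (t : ℝ)
    (x y : Sp) : ‖iteratedFDeriv ℝ N (f t) x - iteratedFDeriv ℝ N (f t) y‖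
      ≤ semN (N + 1) (f t) * ‖x - y‖ := by
  refine convex_univ.norm_image_sub_le_of_norm_fderiv_le (𝕜 := ℝ) (fun z _ => ?_) (fun z _ => ?_)
    (mem_univ y) (mem_univ x)
  · exact ((contDiff_slice hf t).differentiable_iteratedFDeriv (m := N)
        (by exact_mod_cast ENat.natCast_lt_top _)) z
  · rw [norm_fderiv_iteratedFDeriv]
    exact norm_le_semN hf hp _ t z

lemma lipschitz_of_semN {f : ℝ → Sp → E} (hf : SmoothST f) (hp : PerT f) (t : ℝ)
    (x y : Sp) : ‖f t x - f t y‖ ≤ semN 1 (f t) * ‖x - y‖ := by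
  refine convex_univ.norm_image_sub_le_of_norm_fderiv_le (𝕜 := ℝ) (fun z _ => ?_) (fun z _ => ?_)
    (mem_univ y) (mem_univ x)
  · exact (contDiff_slice hf t).differentiable (by simp) z
  · rw [← norm_iteratedFDeriv_one]
    exact norm_le_semN hf hp _ t z

end seminorms

section dlbounds
variable {E : Type*} [NormedAddCommGroup E] [NormedSpace ℝ E]

lemma dl_add {φ ψ : ℝ × Sp → E} (hφ : ContDiff ℝ (⊤ : ℕ∞) φ) (hψ : ContDiff ℝ (⊤ : ℕ∞) ψ)
    (l : List Sp) : dl l (fun z => φ z + ψ z) = fun z => dl l φ z + dl l ψ z := by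
  induction l with
  | nil => rfl
  | cons e l ih =>
    funext z
    simp only [dl]
    rw [ih, fderiv_fun_add ((contDiff_dl hφ l).differentiable (by simp) z)
      ((contDiff_dl hψ l).differentiable (by simp) z), _root_.add_apply]

lemma dl_clm {F : Type*} [NormedAddCommGroup F] [NormedSpace ℝ F] (L : E →L[ℝ] F)
    {φ : ℝ × Sp → E} (hφ : ContDiff ℝ (⊤ : ℕ∞) φ) (l : List Sp) :
    dl l (fun z => L (φ z)) = fun z => L (dl l φ z) := by
  induction l with
  | nil => rfl
  | cons e l ih =>
    funext z
    simp only [dl]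
    rw [ih]
    have := (L.hasFDerivAt.comp z ((contDiff_dl hφ l).differentiable (by simp) z).hasFDerivAt).fderiv
    exact congrArg (fun A => A (0, e)) this

/-- The `i`-th component of a time-dependent vector field as a space-time function. -/
def cmp (u : ℝ → Sp → V3) (i : Fin 3) : ℝ × Sp → ℝ := fun z => u z.1 z.2 i

/-- A time-dependent field as a space-time function. -/
def unc (u : ℝ → Sp → E) : ℝ × Sp → E := fun z => u z.1 z.2

lemma contDiff_cmp {u : ℝ → Sp → V3} (hu : SmoothST u) (i : Fin 3) :
    ContDiff ℝ (⊤ : ℕ∞) (cmp u i) :=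
  contDiff_pi.1 hu i

lemma PerT.cmp {u : ℝ → Sp → V3} (hp : PerT u) (i : Fin 3) : PerZ (cmp u i) := by
  intro z k
  exact congrFun (hp.perZ z k) i

lemma dl_unc {u : ℝ → Sp → E} (hu : SmoothST u) (l : List Sp) (t : ℝ) (x : Sp) :
    dl l (unc u) (t, x) = iteratedFDeriv ℝ l.length (u t) x l.get :=
  dl_eq_iteratedFDeriv hu l t x

lemma dl_cmp {u : ℝ → Sp → V3} (hu : SmoothST u) (i : Fin 3) (l : List Sp) (t : ℝ) (x : Sp) :
    dl l (cmp u i) (t, x) = iteratedFDeriv ℝ l.length (u t) x l.get i := by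
  rw [← dl_unc hu]
  exact congrFun (dl_clm (ContinuousLinearMap.proj i : V3 →L[ℝ] ℝ) (φ := unc u) hu l) (t, x)

lemma multilinear_get_le {l : List Sp} (hl : ∀ e ∈ l, ‖e‖ ≤ 1)
    (A : ContinuousMultilinearMap ℝ (fun _ : Fin l.length => Sp) E) : ‖A l.get‖ ≤ ‖A‖ :=
  (A.le_opNorm _).trans (mul_le_of_le_one_right (norm_nonneg _)
    (Finset.prod_le_one (fun _ _ => norm_nonneg _) fun i _ => hl _ (l.get_mem i)))

lemma multilinear_cons_get_le {l : List Sp} (hl : ∀ e ∈ l, ‖e‖ ≤ 1) (w : Sp)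
    (A : ContinuousMultilinearMap ℝ (fun _ : Fin (l.length + 1) => Sp) E) :
    ‖A (w :: l).get‖ ≤ ‖A‖ * ‖w‖ := by
  refine (A.le_opNorm _).trans (mul_le_mul_of_nonneg_left ?_ (norm_nonneg _))
  rw [Fin.prod_univ_succ]
  exact mul_le_of_le_one_right (norm_nonneg _)
    (Finset.prod_le_one (fun _ _ => norm_nonneg _) fun i _ => hl _ (l.get_mem i))

lemma abs_dl_cmp_sub_le {u : ℝ → Sp → V3} (hu : SmoothST u) (i : Fin 3) {l : List Sp}
    (hl : ∀ e ∈ l, ‖e‖ ≤ 1) (t : ℝ) (x y : Sp) :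
    |dl l (cmp u i) (t, x) - dl l (cmp u i) (t, y)|
      ≤ ‖iteratedFDeriv ℝ l.length (u t) x - iteratedFDeriv ℝ l.length (u t) y‖ := by
  rw [dl_cmp hu, dl_cmp hu]
  exact (norm_le_pi_norm ((iteratedFDeriv ℝ l.length (u t) x - iteratedFDeriv ℝ l.length (u t) y) l.get) i).trans
    (multilinear_get_le hl _)

lemma multilinear_norm_le_of_unit {n : ℕ}
    {A : ContinuousMultilinearMap ℝ (fun _ : Fin n => Sp) E} {c : ℝ} (hc : 0 ≤ c)
    (h : ∀ e : Fin n → Sp, (∀ i, ‖e i‖ ≤ 1) → ‖A e‖ ≤ c) : ‖A‖ ≤ c := by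
  refine ContinuousMultilinearMap.opNorm_le_bound hc fun m => ?_
  by_cases h0 : ∃ i, m i = 0
  · obtain ⟨i, hi⟩ := h0
    rw [A.map_coord_zero i hi, norm_zero]
    exact mul_nonneg hc (Finset.prod_nonneg fun _ _ => norm_nonneg _)
  · push Not at h0
    have e : m = fun i => ‖m i‖ • (‖m i‖⁻¹ • m i) := by
      funext i
      rw [smul_smul, mul_inv_cancel₀ (norm_ne_zero_iff.2 (h0 i)), one_smul]
    have h2 := h (fun i => ‖m i‖⁻¹ • m i) fun i => by
      rw [norm_smul, norm_inv, norm_norm, inv_mul_cancel₀ (norm_ne_zero_iff.2 (h0 i))]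
    rw [e, A.map_smul_univ, norm_smul, norm_prod]
    simp only [norm_norm]
    have e2 : ∀ i, ‖‖m i‖ • (‖m i‖⁻¹ • m i)‖ = ‖m i‖ := fun i => by
      rw [smul_smul, mul_inv_cancel₀ (norm_ne_zero_iff.2 (h0 i)), one_smul]
    simp only [e2]
    rw [mul_comm]
    exact mul_le_mul_of_nonneg_right h2 (Finset.prod_nonneg fun _ _ => norm_nonneg _)

lemma norm_iteratedFDeriv_sub_le {u : ℝ → Sp → V3} (hu : SmoothST u) {n : ℕ} {t : ℝ} {x y : Sp}
    {c : ℝ} (hc : 0 ≤ c) (h : ∀ l : List Sp, l.length = n → (∀ e ∈ l, ‖e‖ ≤ 1) → ∀ i,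
      |dl l (cmp u i) (t, x) - dl l (cmp u i) (t, y)| ≤ c) :
    ‖iteratedFDeriv ℝ n (u t) x - iteratedFDeriv ℝ n (u t) y‖ ≤ c := by
  refine multilinear_norm_le_of_unit hc fun e he => (pi_norm_le_iff_of_nonneg hc).2 fun i => ?_
  have gen : ∀ (l : List Sp) (m : ℕ) (hm : l.length = m) (z : Sp),
      iteratedFDeriv ℝ m (u t) z (fun i => l.get (i.cast hm.symm)) i = dl l (cmp u i) (t, z) := by
    rintro l m rfl z
    rw [dl_cmp hu]
    rfl
  have hlen : (List.ofFn e).length = n := List.length_ofFn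
  have h3 := h (List.ofFn e) hlen (fun e' he' => by
    obtain ⟨j, rfl⟩ := (List.mem_ofFn' e e').1 he'
    exact he j) i
  rw [← gen _ n hlen, ← gen _ n hlen] at h3
  have h4 : (fun i : Fin n => (List.ofFn e).get (i.cast hlen.symm)) = e := by
    funext i
    simp
  rw [h4] at h3
  exact h3

lemma commTerm_eq {v u : ℝ → Sp → V3} (i : Fin 3) (p : List Sp × List Sp) (t : ℝ) (x : Sp) :
    commTerm (unc v) (cmp u i) p (t, x) = dl (dl p.2 (unc v) (t, x) :: p.1) (cmp u i) (t, x) := rfl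

lemma norm_dl_unc_le {v : ℝ → Sp → V3} (hv : SmoothST v) {l : List Sp}
    (hl : ∀ e ∈ l, ‖e‖ ≤ 1) (t : ℝ) (x : Sp) :
    ‖dl l (unc v) (t, x)‖ ≤ ‖iteratedFDeriv ℝ l.length (v t) x‖ := by
  rw [dl_unc hv]
  exact multilinear_get_le hl _

lemma norm_dl_unc_sub_le {v : ℝ → Sp → V3} (hv : SmoothST v) {l : List Sp}
    (hl : ∀ e ∈ l, ‖e‖ ≤ 1) (t : ℝ) (x y : Sp) :
    ‖dl l (unc v) (t, x) - dl l (unc v) (t, y)‖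
      ≤ ‖iteratedFDeriv ℝ l.length (v t) x - iteratedFDeriv ℝ l.length (v t) y‖ := by
  rw [dl_unc hv, dl_unc hv]
  exact multilinear_get_le hl (iteratedFDeriv ℝ l.length (v t) x - iteratedFDeriv ℝ l.length (v t) y)

lemma abs_commTerm_sub_le {v u : ℝ → Sp → V3} (hv : SmoothST v) (hvp : PerT v) (hu : SmoothST u)
    (hup : PerT u) (i : Fin 3) {p : List Sp × List Sp} (h1 : ∀ e ∈ p.1, ‖e‖ ≤ 1)
    (h2 : ∀ e ∈ p.2, ‖e‖ ≤ 1) {α : ℝ} (hα0 : 0 ≤ α) (hα1 : α ≤ 1) (t : ℝ) (x y : Sp) :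
    |commTerm (unc v) (cmp u i) p (t, x) - commTerm (unc v) (cmp u i) p (t, y)|
      ≤ (semH (p.1.length + 1) α (u t) * semN p.2.length (v t)
        + semN (p.1.length + 1) (u t) * semH p.2.length α (v t)) * ‖x - y‖ ^ α := by
  set wx := dl p.2 (unc v) (t, x)
  set wy := dl p.2 (unc v) (t, y)
  have e1 : commTerm (unc v) (cmp u i) p (t, y)
      = dl (wx :: p.1) (cmp u i) (t, y) - dl ((wx - wy) :: p.1) (cmp u i) (t, y) := by
    rw [commTerm_eq]
    simp only [dl]
    rw [← map_sub]
    congr 1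
    ext <;> simp [wx, wy]
  have e2 : commTerm (unc v) (cmp u i) p (t, x) = dl (wx :: p.1) (cmp u i) (t, x) := rfl
  have b1 : |dl (wx :: p.1) (cmp u i) (t, x) - dl (wx :: p.1) (cmp u i) (t, y)|
      ≤ semH (p.1.length + 1) α (u t) * ‖x - y‖ ^ α * semN p.2.length (v t) := by
    rw [dl_cmp hu, dl_cmp hu]
    refine (norm_le_pi_norm ((iteratedFDeriv ℝ (p.1.length + 1) (u t) x
      - iteratedFDeriv ℝ (p.1.length + 1) (u t) y) (wx :: p.1).get) i).trans
      ((multilinear_cons_get_le h1 _ _).trans ?_)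
    exact mul_le_mul (le_semH hu hup _ hα0 hα1 t x y)
      ((norm_dl_unc_le hv h2 t x).trans (norm_le_semN hv hvp _ t x)) (norm_nonneg _)
      (mul_nonneg (semH_nonneg _ _ _) (Real.rpow_nonneg (norm_nonneg _) _))
  have b2 : |dl ((wx - wy) :: p.1) (cmp u i) (t, y)|
      ≤ semN (p.1.length + 1) (u t) * (semH p.2.length α (v t) * ‖x - y‖ ^ α) := by
    rw [dl_cmp hu]
    refine (norm_le_pi_norm (iteratedFDeriv ℝ (p.1.length + 1) (u t) y ((wx - wy) :: p.1).get) i).trans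
      ((multilinear_cons_get_le h1 _ _).trans ?_)
    exact mul_le_mul (norm_le_semN hu hup _ t y)
      ((norm_dl_unc_sub_le hv h2 t x y).trans (le_semH hv hvp _ hα0 hα1 t x y)) (norm_nonneg _)
      (semN_nonneg _ _)
  rw [e1, e2, sub_sub_eq_add_sub, add_sub_right_comm]
  refine (abs_add_le _ _).trans ((add_le_add b1 b2).trans (le_of_eq ?_))
  ring

lemma abs_list_sum_sub_le {ι : Type*} (L : List ι) (a b : ι → ℝ) {c : ℝ}
    (h : ∀ i ∈ L, |a i - b i| ≤ c) : |(L.map a).sum - (L.map b).sum| ≤ L.length * c := by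
  induction L with
  | nil => simp
  | cons i L ih =>
    have h1 := h i (by simp)
    have h2 := ih fun j hj => h j (List.mem_cons_of_mem _ hj)
    simp only [List.map_cons, List.sum_cons, List.length_cons]
    rw [add_sub_add_comm]
    refine (abs_add_le _ _).trans ?_
    push_cast
    linarith

/-- The commutator is controlled by products of lower order seminorms. -/
lemma abs_comm_sub_le {v u : ℝ → Sp → V3} (hv : SmoothST v) (hvp : PerT v) (hu : SmoothST u)
    (hup : PerT u) (i : Fin 3) {l : List Sp} (hl : ∀ e ∈ l, ‖e‖ ≤ 1)
    {α : ℝ} (hα0 : 0 ≤ α) (hα1 : α ≤ 1) {t Q : ℝ} (hQ0 : 0 ≤ Q)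
    (hQ : ∀ j k, j + k + 1 = l.length → semH (k + 1) α (u t) * semN (j + 1) (v t)
        + semN (k + 1) (u t) * semH (j + 1) α (v t) ≤ Q) (x y : Sp) :
    |((commPairs l).map fun p => commTerm (unc v) (cmp u i) p (t, x)).sum
      - ((commPairs l).map fun p => commTerm (unc v) (cmp u i) p (t, y)).sum|
      ≤ 2 ^ l.length * Q * ‖x - y‖ ^ α := by
  have hr : 0 ≤ ‖x - y‖ ^ α := Real.rpow_nonneg (norm_nonneg _) _
  refine (abs_list_sum_sub_le _ _ _ (c := Q * ‖x - y‖ ^ α) fun p hp => ?_).trans ?_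
  · obtain ⟨m1, m2, m3, m4⟩ := mem_commPairs hp
    refine (abs_commTerm_sub_le hv hvp hu hup i (fun e he => hl _ (m3 _ he))
      (fun e he => hl _ (m4 _ he)) hα0 hα1 t x y).trans ?_
    refine mul_le_mul_of_nonneg_right ?_ hr
    have : 0 < p.2.length := List.length_pos_iff.2 m2
    obtain ⟨j, hj⟩ := Nat.exists_eq_add_of_lt this
    rw [zero_add] at hj
    rw [hj]
    exact hQ j p.1.length (by omega)
  · rw [← mul_assoc]
    refine mul_le_mul_of_nonneg_right (mul_le_mul_of_nonneg_right ?_ hQ0) hr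
    have h2 : (commPairs l).length ≤ 2 ^ l.length := (length_commPairs l).trans (Nat.sub_le _ _)
    exact_mod_cast h2

end dlbounds

/-- A smooth periodic solution of the advection-diffusion equation on `[t0, t1]`. -/
structure Sol (ν γ t0 t1 : ℝ) (v u f : ℝ → Sp → V3) : Prop where
  nu_nonneg : 0 ≤ ν
  gamma_pos : 0 < γ
  gamma_le : γ ≤ 1
  le : t0 ≤ t1
  smooth_v : SmoothST v
  per_v : PerT v
  smooth_u : SmoothST u
  per_u : PerT u
  smooth_f : SmoothST f
  per_f : PerT f
  eqn : ∀ t ∈ Ioo t0 t1, ∀ x : Sp, ∀ j, matder v u t x j + ν * fracLapV γ (u t) x j = f t x j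

lemma mat_cmp {v u : ℝ → Sp → V3} (hu : SmoothST u) (t : ℝ) (x : Sp) (i : Fin 3) :
    mat (unc v) (cmp u i) (t, x) = matder v u t x i := by
  have hd := (contDiff_cmp hu i).differentiable (by simp) (t, x)
  have h1 : HasDerivAt (fun s => u s x i) (fderiv ℝ (cmp u i) (t, x) (1, 0)) t := by
    have := HasFDerivAt.comp_hasDerivAt (f := fun s : ℝ => (s, x)) t hd.hasFDerivAt
      ((hasDerivAt_id t).prodMk (hasDerivAt_const t x))
    exact this
  have h2 : ∀ w : Sp, fderiv ℝ (fun y => u t y i) x w = fderiv ℝ (cmp u i) (t, x) (0, w) := by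
    intro w
    have := (hasFDerivAt_slice hd).fderiv
    exact congrArg (fun A => A w) this
  unfold matder mat pd
  rw [h1.deriv]
  have h3 : ∑ m, v t x m * fderiv ℝ (fun y => u t y i) x (Pi.single m 1)
      = fderiv ℝ (fun y => u t y i) x (v t x) := by
    have : v t x = ∑ m, v t x m • (Pi.single m 1 : Sp) := by
      funext j
      simp [Finset.sum_apply, Pi.single_apply]
    conv_rhs => rw [this, map_sum]
    refine Finset.sum_congr rfl fun m _ => ?_
    rw [map_smul, smul_eq_mul]
  rw [h3, h2, ← map_add]
  simp [unc]

namespace Sol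
variable {ν γ t0 t1 : ℝ} {v u f : ℝ → Sp → V3}

lemma mono (h : Sol ν γ t0 t1 v u f) {t : ℝ} (ht : t ∈ Icc t0 t1) : Sol ν γ t0 t v u f :=
  ⟨h.1, h.2, h.3, ht.1, h.5, h.6, h.7, h.8, h.9, h.10,
    fun s hs => h.eqn s ⟨hs.1, hs.2.trans_le ht.2⟩⟩

lemma transMax (h : Sol ν γ t0 t1 v u f) (i : Fin 3) {t : ℝ} (ht : t ∈ Ioo t0 t1) {κ : ℝ}
    (hκ : 0 ≤ κ) : TransMax (fun x => cmp u i (t, x))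
      (fun x => κ * (cmp f i (t, x) - mat (unc v) (cmp u i) (t, x))) := by
  have e : (fun x => κ * (cmp f i (t, x) - mat (unc v) (cmp u i) (t, x)))
      = fun x => (κ * ν) * fracLap γ (fun x => u t x i) x := by
    funext x
    rw [mat_cmp h.smooth_u]
    have := h.eqn t ht x i
    unfold fracLapV at this
    change κ * (f t x i - _) = _
    rw [← this]
    ring
  rw [e]
  exact transMax_fracLap h.gamma_pos h.gamma_le (mul_nonneg hκ h.nu_nonneg)
    (fun x k => congrFun (h.per_u t x k) i)
    (contDiff_slice (contDiff_cmp h.smooth_u i) t).continuous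

/-- Transport estimate for the spatial derivatives of a component of a solution. -/
lemma jet_bound (h : Sol ν γ t0 t1 v u f) (i : Fin 3) (l : List Sp) {L α b m0 : ℝ} {g : ℝ → ℝ}
    (hL : ∀ t ∈ Icc t0 t1, semN 1 (v t) ≤ L)
    (hα0 : 0 ≤ α) (hg0 : ∀ t ∈ Icc t0 t1, 0 ≤ g t) (hgc : ContinuousOn g (Icc t0 t1))
    (hg : ∀ t ∈ Icc t0 t1, ∀ x h, |(dl l (cmp f i) (t, x + h)
        - ((commPairs l).map fun p => commTerm (unc v) (cmp u i) p (t, x + h)).sum)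
        - b * (dl l (cmp f i) (t, x)
          - ((commPairs l).map fun p => commTerm (unc v) (cmp u i) p (t, x)).sum)| ≤ g t * ‖h‖ ^ α)
    (hm0 : 0 ≤ m0)
    (h0 : ∀ x h, |dl l (cmp u i) (t0, x + h) - b * dl l (cmp u i) (t0, x)| ≤ m0 * ‖h‖ ^ α)
    (x k : Sp) : |dl l (cmp u i) (t1, x + k) - b * dl l (cmp u i) (t1, x)|
      ≤ exp (α * L * (t1 - t0)) * (m0 + ∫ τ in t0..t1, g τ) * ‖k‖ ^ α := by
  have hL0 : 0 ≤ L := (semN_nonneg _ _).trans (hL t0 ⟨le_rfl, h.le⟩)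
  have hR : ContDiff ℝ (⊤ : ℕ∞) fun z => cmp f i z - mat (unc v) (cmp u i) z :=
    (contDiff_cmp h.smooth_f i).sub (contDiff_mat h.smooth_v (contDiff_cmp h.smooth_u i))
  have hRp : PerZ fun z => cmp f i z - mat (unc v) (cmp u i) z := fun z k => by
    simp only [h.per_f.cmp i z k, (PerZ.mat (v := unc v) h.per_v.perZ (h.per_u.cmp i)) z k]
  have hsum : ∀ z, mat (unc v) (dl l (cmp u i)) z + dl l (fun z => cmp f i z - mat (unc v) (cmp u i) z) z
      = dl l (cmp f i) z - ((commPairs l).map fun p => commTerm (unc v) (cmp u i) p z).sum := by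
    intro z
    have e1 := congrFun (dl_add hR (contDiff_mat (v := unc v) h.smooth_v (contDiff_cmp h.smooth_u i)) l) z
    simp only [sub_add_cancel] at e1
    have e2 := congrFun (dl_mat (v := unc v) h.smooth_v (contDiff_cmp h.smooth_u i) l) z
    have e3 : dl l (fun z => cmp f i z) z = dl l (cmp f i) z := rfl
    have e4 : dl l (fun z => mat (unc v) (cmp u i) z) z = dl l (mat (unc v) (cmp u i)) z := rfl
    rw [e3, e4] at e1
    linarith
  refine transport_bound (R := dl l fun z => cmp f i z - mat (unc v) (cmp u i) z) (v := unc v)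
    h.le (contDiff_dl (contDiff_cmp h.smooth_u i) l)
    ((h.per_u.cmp i).dl l) h.smooth_v h.per_v.perZ
    (fun t ht κ hκ => transMax_dl (contDiff_cmp h.smooth_u i) (h.per_u.cmp i) hR hRp
      (h.transMax i ht hκ) l) hL0 (fun t ht x y => ?_) hα0 hg0 hgc (fun t ht x k => ?_) hm0 h0 x k
  · exact (lipschitz_of_semN h.smooth_v h.per_v t x y).trans
      (mul_le_mul_of_nonneg_right (hL t ht) (norm_nonneg _))
  · rw [hsum, hsum]
    exact hg t ht x k

lemma C0_le (h : Sol ν γ t0 t1 v u f) :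
    C0 (u t1) ≤ C0 (u t0) + ∫ τ in t0..t1, C0 (f τ) := by
  have hint : 0 ≤ ∫ τ in t0..t1, C0 (f τ) :=
    intervalIntegral.integral_nonneg h.le fun _ _ => C0_nonneg _
  refine ciSup_le fun x => (pi_norm_le_iff_of_nonneg (add_nonneg (C0_nonneg _) hint)).2 fun i => ?_
  have := h.jet_bound i [] (L := semNT 1 v t0 t1) (α := 0) (b := 0) (m0 := C0 (u t0))
    (g := fun t => C0 (f t))
    (fun t ht => semN_le_semNT h.smooth_v h.per_v 1 ht) le_rfl (fun _ _ => C0_nonneg _)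
    (continuousOn_C0 h.smooth_f h.per_f t0 t1)
    (fun t _ x k => by
      simp only [dl, commPairs, List.map_nil, List.sum_nil, sub_zero, zero_mul, Real.rpow_zero, mul_one]
      exact (norm_le_pi_norm (f t (x + k)) i).trans (norm_le_C0 h.smooth_f h.per_f t _))
    (C0_nonneg _)
    (fun x k => by
      simp only [dl, sub_zero, zero_mul, Real.rpow_zero, mul_one]
      exact (norm_le_pi_norm (u t0 (x + k)) i).trans (norm_le_C0 h.smooth_u h.per_u t0 _)) x 0
  simpa [dl, cmp] using this

lemma semH_le (h : Sol ν γ t0 t1 v u f) (N : ℕ) {L α : ℝ} {Q : ℝ → ℝ}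
    (hL : ∀ t ∈ Icc t0 t1, semN 1 (v t) ≤ L) (hα0 : 0 ≤ α) (hα1 : α ≤ 1)
    (hQ0 : ∀ t ∈ Icc t0 t1, 0 ≤ Q t) (hQc : ContinuousOn Q (Icc t0 t1))
    (hQ : ∀ t ∈ Icc t0 t1, ∀ j k, j + k + 1 = N → semH (k + 1) α (u t) * semN (j + 1) (v t)
        + semN (k + 1) (u t) * semH (j + 1) α (v t) ≤ Q t) :
    semH N α (u t1) ≤ exp (α * L * (t1 - t0))
      * (semH N α (u t0) + ∫ τ in t0..t1, (semH N α (f τ) + 2 ^ N * Q τ)) := by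
  have hg0 : ∀ t ∈ Icc t0 t1, 0 ≤ semH N α (f t) + 2 ^ N * Q t := fun t ht =>
    add_nonneg (semH_nonneg _ _ _) (mul_nonneg (by positivity) (hQ0 t ht))
  have hint : 0 ≤ ∫ τ in t0..t1, (semH N α (f τ) + 2 ^ N * Q τ) :=
    intervalIntegral.integral_nonneg h.le hg0
  refine FNS.semH_le fun x y => norm_iteratedFDeriv_sub_le h.smooth_u
    (mul_nonneg (mul_nonneg (exp_pos _).le (add_nonneg (semH_nonneg _ _ _) hint))
      (Real.rpow_nonneg (norm_nonneg _) _)) fun l hl hle i => ?_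
  have := h.jet_bound i l (L := L) (α := α) (b := 1) (m0 := semH N α (u t0))
    (g := fun t => semH N α (f t) + 2 ^ N * Q t) hL hα0 hg0
    ((continuousOn_semH h.smooth_f h.per_f N hα0 hα1 t0 t1).add (continuousOn_const.mul hQc))
    (fun t ht x k => by
      have h1 := abs_dl_cmp_sub_le h.smooth_f i hle t (x + k) x
      have h2 := abs_comm_sub_le h.smooth_v h.per_v h.smooth_u h.per_u i hle hα0 hα1 (hQ0 t ht)
        (fun j k hjk => hQ t ht j k (by omega)) (x + k) x
      have h3 := le_semH h.smooth_f h.per_f l.length hα0 hα1 t (x + k) x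
      rw [add_sub_cancel_left] at h2 h3
      rw [hl] at h2 h3 h1
      rw [one_mul, sub_sub_sub_comm]
      refine (abs_sub _ _).trans ?_
      rw [add_mul]
      exact add_le_add (h1.trans h3) h2)
    (semH_nonneg _ _ _)
    (fun x k => by
      have h1 := abs_dl_cmp_sub_le h.smooth_u i hle t0 (x + k) x
      have h3 := le_semH h.smooth_u h.per_u l.length hα0 hα1 t0 (x + k) x
      rw [add_sub_cancel_left] at h3
      rw [hl] at h1 h3
      rw [one_mul]
      exact h1.trans h3) y (x - y)
  rw [add_sub_cancel, one_mul] at this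
  exact this

lemma semH_zero_le (h : Sol ν γ t0 t1 v u f) {L α : ℝ}
    (hL : ∀ t ∈ Icc t0 t1, semN 1 (v t) ≤ L) (hα0 : 0 ≤ α) (hα1 : α ≤ 1) :
    semH 0 α (u t1) ≤ exp (α * L * (t1 - t0))
      * (semH 0 α (u t0) + ∫ τ in t0..t1, semH 0 α (f τ)) := by
  have := h.semH_le 0 (Q := fun _ => 0) hL hα0 hα1 (fun _ _ => le_rfl) continuousOn_const
    (fun t ht j k hjk => by omega)
  simpa using this

/-- The low-order Hölder estimate. -/
lemma nrmH_le (h : Sol ν γ t0 t1 v u f) {L α : ℝ}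
    (hL : ∀ t ∈ Icc t0 t1, semN 1 (v t) ≤ L) (hLt : (t1 - t0) * L ≤ 1)
    (hα0 : 0 ≤ α) (hα1 : α ≤ 1) :
    nrmH α (u t1) ≤ exp α * (nrmH α (u t0) + ∫ τ in t0..t1, nrmH α (f τ)) := by
  have h1 := h.C0_le
  have h2 := h.semH_zero_le hL hα0 hα1
  have i1 : 0 ≤ ∫ τ in t0..t1, C0 (f τ) :=
    intervalIntegral.integral_nonneg h.le fun _ _ => C0_nonneg _
  have i2 : 0 ≤ ∫ τ in t0..t1, semH 0 α (f τ) :=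
    intervalIntegral.integral_nonneg h.le fun _ _ => semH_nonneg _ _ _
  have e1 : exp (α * L * (t1 - t0)) ≤ exp α := by
    rw [Real.exp_le_exp, mul_assoc]
    exact mul_le_of_le_one_right hα0 (by linarith)
  have e2 : 1 ≤ exp α := Real.one_le_exp hα0
  have c0 := C0_nonneg (u t0)
  have s0 := semH_nonneg 0 α (u t0)
  unfold nrmH
  rw [intervalIntegral.integral_add
    ((continuousOn_C0 h.smooth_f h.per_f t0 t1).intervalIntegrable_of_Icc h.le)
    ((continuousOn_semH h.smooth_f h.per_f 0 hα0 hα1 t0 t1).intervalIntegrable_of_Icc h.le)]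
  have h3 : semH 0 α (u t1) ≤ exp α * (semH 0 α (u t0) + ∫ τ in t0..t1, semH 0 α (f τ)) :=
    h2.trans (mul_le_mul_of_nonneg_right e1 (by positivity))
  have h4 : C0 (u t1) ≤ exp α * (C0 (u t0) + ∫ τ in t0..t1, C0 (f τ)) :=
    h1.trans (le_mul_of_one_le_left (by positivity) e2)
  linarith

end Sol

section interpolation
variable {E : Type*} [NormedAddCommGroup E] [NormedSpace ℝ E]

lemma norm_fderiv_iteratedFDeriv_sub (g : Sp → E) (j : ℕ) (x y : Sp) :
    ‖fderiv ℝ (iteratedFDeriv ℝ j g) x - fderiv ℝ (iteratedFDeriv ℝ j g) y‖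
      = ‖iteratedFDeriv ℝ (j + 1) g x - iteratedFDeriv ℝ (j + 1) g y‖ := by
  have := (continuousMultilinearCurryLeftEquiv ℝ (fun _ : Fin (j + 1) => Sp) E).symm.dist_map
    (fderiv ℝ (iteratedFDeriv ℝ j g) x) (fderiv ℝ (iteratedFDeriv ℝ j g) y)
  rw [dist_eq_norm, dist_eq_norm] at this
  rw [iteratedFDeriv_succ_eq_comp_left]
  exact this.symm

/-- One interpolation step: the `j+1`-st derivatives are controlled by the `j`-th ones and
a Hölder bound. -/
lemma semN_succ_le {f : ℝ → Sp → E} (hf : SmoothST f) (hp : PerT f) (t : ℝ) (j : ℕ) {W β r : ℝ}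
    (hβ : 0 ≤ β) (hr : 0 < r)
    (hW : ∀ x y, ‖iteratedFDeriv ℝ (j + 1) (f t) x - iteratedFDeriv ℝ (j + 1) (f t) y‖
      ≤ W * ‖x - y‖ ^ β) :
    r * semN (j + 1) (f t) ≤ 2 * semN j (f t) + r * r ^ β * W := by
  have hs : ContDiff ℝ (⊤ : ℕ∞) (f t) := contDiff_slice hf t
  have hd : Differentiable ℝ (iteratedFDeriv ℝ j (f t)) :=
    hs.differentiable_iteratedFDeriv (by exact_mod_cast ENat.natCast_lt_top j)
  have hW0 : 0 ≤ W := by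
    have := hW 0 1
    have h1 : ‖(0 : Sp) - 1‖ = 1 := by simp
    rw [h1, Real.one_rpow, mul_one] at this
    exact (norm_nonneg _).trans this
  have hR : 0 ≤ 2 * semN j (f t) + r * r ^ β * W := by
    have := semN_nonneg j (f t)
    positivity
  rw [mul_comm, ← le_div_iff₀ hr]
  refine ciSup_le fun x => ?_
  rw [← norm_fderiv_iteratedFDeriv]
  refine ContinuousLinearMap.opNorm_le_of_unit_norm (div_nonneg hR hr.le) fun e he => ?_
  have hmv := (convex_closedBall x r).norm_image_sub_le_of_norm_fderiv_le' (𝕜 := ℝ)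
    (f := iteratedFDeriv ℝ j (f t)) (φ := fderiv ℝ (iteratedFDeriv ℝ j (f t)) x)
    (C := W * r ^ β) (x := x) (y := x + r • e) (fun y _ => hd y) (fun y hy => by
      rw [norm_fderiv_iteratedFDeriv_sub]
      refine (hW y x).trans (mul_le_mul_of_nonneg_left ?_ hW0)
      exact Real.rpow_le_rpow (norm_nonneg _) (by rwa [← dist_eq_norm]) hβ)
    (Metric.mem_closedBall_self hr.le) (by simp [norm_smul, he, abs_of_pos hr])
  rw [add_sub_cancel_left, map_smul, norm_smul, he, Real.norm_of_nonneg hr.le, mul_one] at hmv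
  have h1 := norm_le_semN hf hp j t (x + r • e)
  have h2 := norm_le_semN hf hp j t x
  rw [le_div_iff₀ hr]
  have h3 : ‖fderiv ℝ (iteratedFDeriv ℝ j (f t)) x e‖ * r
      = ‖r • fderiv ℝ (iteratedFDeriv ℝ j (f t)) x e‖ := by
    rw [norm_smul, Real.norm_of_nonneg hr.le, mul_comm]
  rw [h3]
  have h4 := norm_sub_le (iteratedFDeriv ℝ j (f t) (x + r • e) - iteratedFDeriv ℝ j (f t) x)
    (iteratedFDeriv ℝ j (f t) (x + r • e) - iteratedFDeriv ℝ j (f t) x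
      - r • fderiv ℝ (iteratedFDeriv ℝ j (f t)) x e)
  rw [sub_sub_cancel] at h4
  have h5 := norm_sub_le (iteratedFDeriv ℝ j (f t) (x + r • e)) (iteratedFDeriv ℝ j (f t) x)
  nlinarith

/-- Discrete interpolation. -/
lemma interp_seq (n : ℕ) : ∃ C : ℝ, 1 ≤ C ∧ ∀ (a : ℕ → ℝ) (h : ℝ), (∀ j, 0 ≤ a j) → 0 ≤ h →
    (∀ j, j + 2 ≤ n → ∀ ε : ℝ, 0 < ε → a (j + 1) ≤ 2 / ε * a j + ε * a (j + 2)) →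
    (∀ j, j + 1 = n → a (j + 1) ≤ 2 * a j + h) → ∀ j ≤ n, a j ≤ C * (a 0 + h) := by
  refine ⟨(2 * 8 ^ (n + 1)) ^ n, one_le_pow₀ (by
    have : (1 : ℝ) ≤ 8 ^ (n + 1) := one_le_pow₀ (by norm_num)
    linarith), fun a h ha hh h1 h2 => ?_⟩
  have key : ∀ i j, j + 1 + i = n → a (j + 1) ≤ 8 ^ (i + 1) * (a j + h) := by
    intro i
    induction i with
    | zero =>
      intro j hj
      have := h2 j hj
      have := ha j
      norm_num
      linarith
    | succ i ih =>
      intro j hj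
      have e1 := ih (j + 1) (by omega)
      set c : ℝ := 8 ^ (i + 1) with hc
      have hc1 : 1 ≤ c := one_le_pow₀ (by norm_num)
      have e2 := h1 j (by omega) (1 / (2 * c)) (by positivity)
      have e3 : 1 / (2 * c) * a (j + 2) ≤ 1 / (2 * c) * (c * (a (j + 1) + h)) :=
        mul_le_mul_of_nonneg_left e1 (by positivity)
      have e4 : 1 / (2 * c) * (c * (a (j + 1) + h)) = (a (j + 1) + h) / 2 := by
        field_simp
      have e5 : 2 / (1 / (2 * c)) * a j = 4 * c * a j := by
        field_simp; ring
      rw [pow_succ, ← hc]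
      nlinarith [mul_nonneg (sub_nonneg.2 hc1) hh]
  set B : ℝ := 8 ^ (n + 1) with hB
  have hB1 : 1 ≤ B := one_le_pow₀ (by norm_num)
  have key2 : ∀ j, j + 1 ≤ n → a (j + 1) ≤ B * (a j + h) := by
    intro j hj
    refine (key (n - (j + 1)) j (by omega)).trans
      (mul_le_mul_of_nonneg_right ?_ (add_nonneg (ha j) hh))
    exact pow_le_pow_right₀ (by norm_num) (by omega)
  have key3 : ∀ j ≤ n, a j ≤ (2 * B) ^ j * (a 0 + h) := by
    intro j
    induction j with
    | zero => intro _; simpa using hh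
    | succ j ih =>
      intro hj
      have e1 := key2 j hj
      have e2 := ih (by omega)
      have e3 : (1 : ℝ) ≤ (2 * B) ^ j := one_le_pow₀ (by linarith)
      have e4 : h ≤ (2 * B) ^ j * (a 0 + h) := by
        have := ha 0
        nlinarith
      rw [pow_succ]
      nlinarith
  intro j hj
  refine (key3 j hj).trans (mul_le_mul_of_nonneg_right
    (pow_le_pow_right₀ (by linarith) hj) (add_nonneg (ha 0) hh))

/-- Interpolation of the intermediate seminorms between `[f]_1` and `[f]_{N+α}`. -/
lemma interp_sem (n : ℕ) : ∃ C : ℝ, 1 ≤ C ∧ ∀ (f : ℝ → Sp → E), SmoothST f → PerT f →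
    ∀ α : ℝ, 0 ≤ α → α ≤ 1 → ∀ t r : ℝ, 0 < r → ∀ j ≤ n,
      r ^ j * semN (j + 1) (f t)
          ≤ C * (semN 1 (f t) + r ^ n * r ^ α * semH (n + 1) α (f t)) ∧
      r ^ j * r ^ α * semH (j + 1) α (f t)
          ≤ C * (semN 1 (f t) + r ^ n * r ^ α * semH (n + 1) α (f t)) := by
  obtain ⟨C, hC1, hC⟩ := interp_seq n
  refine ⟨3 * C, by linarith, fun f hf hp α hα0 hα1 t r hr => ?_⟩
  have hh : 0 ≤ r ^ n * r ^ α * semH (n + 1) α (f t) := by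
    have := semH_nonneg (n + 1) α (f t)
    positivity
  have main := hC (fun j => r ^ j * semN (j + 1) (f t)) _
    (fun j => mul_nonneg (by positivity) (semN_nonneg _ _)) hh
    (fun j hj ε hε => by
      have := semN_succ_le hf hp t (j + 1) (W := semN (j + 3) (f t)) (β := 1) zero_le_one
        (mul_pos hε hr) (fun x y => by
          rw [Real.rpow_one]; exact lipschitz_iteratedFDeriv hf hp (j + 2) t x y)
      rw [Real.rpow_one] at this
      have h2 : r ^ (j + 1) * semN (j + 1 + 1) (f t) * ε = r ^ j * (ε * r * semN (j + 1 + 1) (f t)) := by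
        ring
      have h3 : (2 / ε * (r ^ j * semN (j + 1) (f t)) + ε * (r ^ (j + 2) * semN (j + 2 + 1) (f t))) * ε
          = r ^ j * (2 * semN (j + 1) (f t) + ε * r * (ε * r) * semN (j + 3) (f t)) := by
        field_simp
        ring
      refine le_of_mul_le_mul_right ?_ hε
      rw [h2, h3]
      exact mul_le_mul_of_nonneg_left this (by positivity))
    (fun j hj => by
      subst hj
      have := semN_succ_le hf hp t (j + 1) (W := semH (j + 2) α (f t)) hα0 hr
        (fun x y => le_semH hf hp (j + 2) hα0 hα1 t x y)
      have h1 := mul_le_mul_of_nonneg_left this (pow_nonneg hr.le j)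
      simp only [pow_succ] at *
      linarith)
  simp only [pow_zero, one_mul, zero_add] at main
  set X := semN 1 (f t) + r ^ n * r ^ α * semH (n + 1) α (f t) with hX
  have hX0 : 0 ≤ X := add_nonneg (semN_nonneg _ _) hh
  have hCX : 0 ≤ C * X := mul_nonneg (by linarith) hX0
  intro j hj
  refine ⟨by linarith [main j hj], ?_⟩
  rcases hj.eq_or_lt with rfl | hj'
  · have : 1 * X ≤ C * X := mul_le_mul_of_nonneg_right hC1 hX0
    have := semN_nonneg 1 (f t)
    linarith
  · have m1 := main j hj
    have m2 := main (j + 1) hj'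
    have hk : 0 ≤ 2 * semN (j + 1) (f t) + r * semN (j + 2) (f t) := by
      have := semN_nonneg (j + 1) (f t)
      have := semN_nonneg (j + 2) (f t)
      positivity
    have hs : semH (j + 1) α (f t)
        ≤ (2 * semN (j + 1) (f t) + r * semN (j + 2) (f t)) / r ^ α := by
      refine semH_le fun x y => ?_
      have n1 := semN_nonneg (j + 1) (f t)
      have n2 := semN_nonneg (j + 2) (f t)
      have := le_rpow_of_le_of_le
        (A := ‖iteratedFDeriv ℝ (j + 1) (f t) x - iteratedFDeriv ℝ (j + 1) (f t) y‖)
        (r := ‖x - y‖ / r) (α := α) (by positivity) hα0 hα1 hk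
        (by
          have := norm_sub_le (iteratedFDeriv ℝ (j + 1) (f t) x) (iteratedFDeriv ℝ (j + 1) (f t) y)
          have := norm_le_semN hf hp (j + 1) t x
          have := norm_le_semN hf hp (j + 1) t y
          have : 0 ≤ r * semN (j + 2) (f t) := by positivity
          linarith)
        (by
          have h1 := lipschitz_iteratedFDeriv hf hp (j + 1) t x y
          have h2 : (2 * semN (j + 1) (f t) + r * semN (j + 2) (f t)) * (‖x - y‖ / r)
              = 2 * semN (j + 1) (f t) * (‖x - y‖ / r) + semN (j + 1 + 1) (f t) * ‖x - y‖ := by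
            field_simp
          rw [h2]
          have : 0 ≤ 2 * semN (j + 1) (f t) * (‖x - y‖ / r) := by positivity
          linarith)
      rw [Real.div_rpow (norm_nonneg _) hr.le] at this
      rwa [div_mul_eq_mul_div, ← mul_div_assoc']
    rw [le_div_iff₀ (Real.rpow_pos_of_pos hr _)] at hs
    have hs' := mul_le_mul_of_nonneg_left hs (pow_nonneg hr.le j)
    rw [pow_succ] at m2
    nlinarith

end interpolation

lemma optimize_scale {P c a A b B : ℝ} (hc : 0 ≤ c) (ha : 0 ≤ a) (hA : 0 ≤ A) (hb : 0 ≤ b)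
    (hB : 0 ≤ B) (h : ∀ μ : ℝ, 0 < μ → μ * P ≤ c * ((b + μ * B) * (a + μ * A))) :
    P ≤ c * (2 * (a * B + A * b)) := by
  refine le_of_forall_pos_le_add fun δ hδ => ?_
  set η := δ / (c * (b + B) + 1) with hη
  have hd : 0 < c * (b + B) + 1 := by positivity
  have hη0 : 0 < η := div_pos hδ hd
  have hηδ : c * (b + B) * η ≤ δ := by
    rw [hη, mul_div_assoc', div_le_iff₀ hd]
    nlinarith
  have h1 := h ((a + η) / (A + η)) (by positivity)
  have hμ : 0 < (a + η) / (A + η) := by positivity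
  set μ := (a + η) / (A + η) with hμd
  have e1 : μ * (A + η) = a + η := by rw [hμd]; field_simp
  have h2 : (b + μ * B) * (a + μ * A) ≤ μ * (2 * (a * B + A * b) + η * (b + B)) := by
    have x1 : a ≤ μ * (A + η) := by linarith
    have x2 : μ * A ≤ a + η := by nlinarith
    have y1 : b * a ≤ b * (μ * (A + η)) := mul_le_mul_of_nonneg_left x1 hb
    have y2 : μ * B * (μ * A) ≤ μ * B * (a + η) := mul_le_mul_of_nonneg_left x2 (by positivity)
    nlinarith
  have h3 : μ * P ≤ μ * (c * (2 * (a * B + A * b) + η * (b + B))) := by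
    refine h1.trans ((mul_le_mul_of_nonneg_left h2 hc).trans (le_of_eq (by ring)))
  have h4 := le_of_mul_le_mul_left h3 hμ
  linarith

/-- Product interpolation for the commutator terms. -/
lemma interp_product (N : ℕ) (α : ℝ) (hα0 : 0 ≤ α) (hα1 : α ≤ 1) :
    ∃ C : ℝ, 0 ≤ C ∧ ∀ v u : ℝ → Sp → V3, SmoothST v → PerT v → SmoothST u → PerT u →
      ∀ t : ℝ, ∀ j k : ℕ, j + k + 1 = N →
        semH (k + 1) α (u t) * semN (j + 1) (v t) + semN (k + 1) (u t) * semH (j + 1) α (v t)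
          ≤ C * (semN 1 (v t) * semH N α (u t) + semH N α (v t) * semN 1 (u t)) := by
  obtain ⟨C, hC1, hC⟩ := interp_sem (E := V3) (N - 1)
  refine ⟨2 * C ^ 2 * 2 + 1, by positivity, fun v u hv pv hu pu t j k hjk => ?_⟩
  have n1 := semN_nonneg 1 (v t)
  have n2 := semN_nonneg 1 (u t)
  have n3 := semH_nonneg N α (v t)
  have n4 := semH_nonneg N α (u t)
  have hS : 0 ≤ semN 1 (v t) * semH N α (u t) + semH N α (v t) * semN 1 (u t) := by positivity
  by_cases hN : N = 1
  · have hj : j = 0 := by omega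
    have hk : k = 0 := by omega
    subst hj hk hN
    have : 0 ≤ 2 * C ^ 2 * 2 * (semN 1 (v t) * semH 1 α (u t) + semH 1 α (v t) * semN 1 (u t)) := by
      positivity
    simp only [zero_add]
    linarith
  have hK : 0 < ((N - 1 : ℕ) : ℝ) + α := by
    have : (1 : ℝ) ≤ ((N - 1 : ℕ) : ℝ) := by exact_mod_cast (by omega : 1 ≤ N - 1)
    linarith
  have hN1 : N - 1 + 1 = N := by omega
  have := optimize_scale (P := semH (k + 1) α (u t) * semN (j + 1) (v t)
      + semN (k + 1) (u t) * semH (j + 1) α (v t)) (c := 2 * C ^ 2) (by positivity) n1 n3 n2 n4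
    (fun μ hμ => by
      set r := μ ^ (((N - 1 : ℕ) : ℝ) + α)⁻¹ with hr
      have hr0 : 0 < r := Real.rpow_pos_of_pos hμ _
      have hrK : r ^ (N - 1) * r ^ α = μ := by
        rw [← Real.rpow_natCast, ← Real.rpow_add hr0, hr, ← Real.rpow_mul hμ.le,
          inv_mul_cancel₀ hK.ne', Real.rpow_one]
      obtain ⟨u1, u2⟩ := hC u hu pu α hα0 hα1 t r hr0 k (by omega)
      obtain ⟨v1, v2⟩ := hC v hv pv α hα0 hα1 t r hr0 j (by omega)
      rw [hN1, hrK] at u1 u2 v1 v2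
      have hsplit : μ = r ^ j * r ^ k * r ^ α := by
        rw [← hrK, ← pow_add]
        congr 2
        omega
      have m1 := semN_nonneg (j + 1) (v t)
      have m2 := semN_nonneg (k + 1) (u t)
      have m3 := semH_nonneg (j + 1) α (v t)
      have m4 := semH_nonneg (k + 1) α (u t)
      have p1 := mul_le_mul u2 v1 (by positivity) (by positivity)
      have p2 := mul_le_mul u1 v2 (by positivity) (by positivity)
      have e : μ * (semH (k + 1) α (u t) * semN (j + 1) (v t)
          + semN (k + 1) (u t) * semH (j + 1) α (v t))
        = r ^ k * r ^ α * semH (k + 1) α (u t) * (r ^ j * semN (j + 1) (v t))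
          + r ^ k * semN (k + 1) (u t) * (r ^ j * r ^ α * semH (j + 1) α (v t)) := by
        rw [hsplit]; ring
      rw [e]
      linarith)
  linarith

lemma hasDerivAt_primitive {φ : ℝ → ℝ} (hφ : Continuous φ) (a x : ℝ) :
    HasDerivAt (fun τ => ∫ s in a..τ, φ s) (φ x) x :=
  intervalIntegral.integral_hasDerivAt_right (hφ.intervalIntegrable _ _)
    hφ.stronglyMeasurable.stronglyMeasurableAtFilter hφ.continuousAt

lemma integral_integral_eq {φ : ℝ → ℝ} (hφ : Continuous φ) (a b : ℝ) :
    ∫ τ in a..b, ∫ s in a..τ, φ s = ∫ s in a..b, (b - s) * φ s := by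
  have := intervalIntegral.integral_mul_deriv_eq_deriv_mul (a := a) (b := b)
    (u := fun τ => ∫ s in a..τ, φ s) (u' := φ) (v := fun τ => τ - b) (v' := fun _ => 1)
    (fun x _ => hasDerivAt_primitive hφ a x) (fun x _ => (hasDerivAt_id x).sub_const b)
    (hφ.intervalIntegrable _ _) (continuous_const.intervalIntegrable _ _)
  simp only [mul_one, sub_self, mul_zero, intervalIntegral.integral_same, zero_mul, zero_sub] at this
  rw [this, ← intervalIntegral.integral_neg]
  congr 1
  funext s
  ring

/-- Grönwall's inequality in integral form. -/
lemma gronwall_integral {y : ℝ → ℝ} {G k a b : ℝ} (hy : Continuous y) (hy0 : ∀ t, 0 ≤ y t)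
    (hk : 0 ≤ k) (hG : 0 ≤ G) (hab : a ≤ b)
    (h : ∀ t ∈ Icc a b, y t ≤ G + k * ∫ s in a..t, y s) : y b ≤ G * exp (k * (b - a)) := by
  have hd : ∀ x, HasDerivAt (fun τ => G + k * ∫ s in a..τ, y s) (k * y x) x := fun x =>
    ((hasDerivAt_primitive hy a x).const_mul k).const_add G
  have := norm_le_gronwallBound_of_norm_deriv_right_le (f := fun τ => G + k * ∫ s in a..τ, y s)
    (f' := fun x => k * y x) (δ := G) (K := k) (ε := 0) (a := a) (b := b)
    (fun x _ => (hd x).continuousAt.continuousWithinAt) (fun x _ => (hd x).hasDerivWithinAt)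
    (by simp [abs_of_nonneg hG]) (fun x hx => by
      have h1 := h x ⟨hx.1, hx.2.le⟩
      rw [Real.norm_of_nonneg (mul_nonneg hk (hy0 x)), Real.norm_of_nonneg ((hy0 x).trans h1),
        add_zero]
      exact mul_le_mul_of_nonneg_left h1 hk) b ⟨hab, le_rfl⟩
  rw [gronwallBound_ε0] at this
  exact (h b ⟨hab, le_rfl⟩).trans ((le_abs_self _).trans this)

lemma continuous_of_continuousOn_Icc {g : ℝ → ℝ} (h : ∀ a b : ℝ, ContinuousOn g (Icc a b)) :
    Continuous g :=
  continuous_iff_continuousAt.2 fun x =>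
    (h (x - 1) (x + 1)).continuousAt (Icc_mem_nhds (by linarith) (by linarith))

section
variable {E : Type*} [NormedAddCommGroup E] [NormedSpace ℝ E]

lemma continuous_semN {f : ℝ → Sp → E} (hf : SmoothST f) (hp : PerT f) (N : ℕ) :
    Continuous fun t => semN N (f t) :=
  continuous_of_continuousOn_Icc fun a b => continuousOn_semN hf hp N a b

lemma continuous_semH {f : ℝ → Sp → E} (hf : SmoothST f) (hp : PerT f) (N : ℕ) {α : ℝ}
    (hα0 : 0 ≤ α) (hα1 : α ≤ 1) : Continuous fun t => semH N α (f t) :=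
  continuous_of_continuousOn_Icc fun a b => continuousOn_semH hf hp N hα0 hα1 a b

/-- The first derivative seminorm is the Lipschitz seminorm. -/
lemma semH_zero_one {f : ℝ → Sp → E} (hf : SmoothST f) (hp : PerT f) (t : ℝ) :
    semH 0 1 (f t) = semN 1 (f t) := by
  refine le_antisymm (FNS.semH_le fun x y => ?_) (ciSup_le fun x => ?_)
  · rw [Real.rpow_one]
    exact lipschitz_iteratedFDeriv hf hp 0 t x y
  · rw [← norm_fderiv_iteratedFDeriv]
    refine norm_fderiv_le_of_lip' ℝ (semH_nonneg _ _ _) (Eventually.of_forall fun y => ?_)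
    have := le_semH hf hp 0 zero_le_one le_rfl t y x
    rwa [Real.rpow_one] at this

end

namespace Sol
variable {ν γ t0 t1 : ℝ} {v u f : ℝ → Sp → V3}

lemma semN_one_le (h : Sol ν γ t0 t1 v u f) {L : ℝ}
    (hL : ∀ t ∈ Icc t0 t1, semN 1 (v t) ≤ L) (hLt : (t1 - t0) * L ≤ 1) {τ : ℝ}
    (hτ : τ ∈ Icc t0 t1) :
    semN 1 (u τ) ≤ exp 1 * (semN 1 (u t0) + ∫ s in t0..τ, semN 1 (f s)) := by
  have hL0 : 0 ≤ L := (semN_nonneg _ _).trans (hL t0 ⟨le_rfl, h.le⟩)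
  have := (h.mono hτ).semH_zero_le (fun t ht => hL t ⟨ht.1, ht.2.trans hτ.2⟩) zero_le_one le_rfl
  simp only [semH_zero_one h.smooth_u h.per_u, semH_zero_one h.smooth_f h.per_f] at this
  have hi : 0 ≤ ∫ s in t0..τ, semN 1 (f s) :=
    intervalIntegral.integral_nonneg hτ.1 fun _ _ => semN_nonneg _ _
  refine this.trans (mul_le_mul_of_nonneg_right ?_ (add_nonneg (semN_nonneg _ _) hi))
  rw [Real.exp_le_exp]
  nlinarith [hτ.1, hτ.2]

/-- The higher-order Hölder estimate. -/
lemma semH_succ_le (h : Sol ν γ t0 t1 v u f) (N : ℕ) {L A α c : ℝ} (hc : 0 ≤ c)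
    (hα0 : 0 ≤ α) (hα1 : α ≤ 1)
    (hL : ∀ t ∈ Icc t0 t1, semN 1 (v t) ≤ L) (hLt : (t1 - t0) * L ≤ 1)
    (hA : ∀ t ∈ Icc t0 t1, semH N α (v t) ≤ A)
    (hprod : ∀ t : ℝ, ∀ j k : ℕ, j + k + 1 = N →
        semH (k + 1) α (u t) * semN (j + 1) (v t) + semN (k + 1) (u t) * semH (j + 1) α (v t)
          ≤ c * (semN 1 (v t) * semH N α (u t) + semH N α (v t) * semN 1 (u t))) :
    semH N α (u t1) ≤ exp 1 * exp (exp 1 * 2 ^ N * c) * (1 + 2 ^ N * c * exp 1)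
      * (semH N α (u t0) + (t1 - t0) * A * semN 1 (u t0)
        + ∫ τ in t0..t1, (semH N α (f τ) + (t1 - τ) * A * semN 1 (f τ))) := by
  have hle := h.le
  have hL0 : 0 ≤ L := (semN_nonneg _ _).trans (hL t0 ⟨le_rfl, hle⟩)
  have hA0 : 0 ≤ A := (semH_nonneg _ _ _).trans (hA t0 ⟨le_rfl, hle⟩)
  have cy := continuous_semH h.smooth_u h.per_u N hα0 hα1
  have cb := continuous_semN h.smooth_u h.per_u 1
  have cF := continuous_semH h.smooth_f h.per_f N hα0 hα1
  have cφ := continuous_semN h.smooth_f h.per_f 1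
  have y0 : ∀ t, 0 ≤ semH N α (u t) := fun t => semH_nonneg _ _ _
  have b0 : ∀ t, 0 ≤ semN 1 (u t) := fun t => semN_nonneg _ _
  have F0 : ∀ t, 0 ≤ semH N α (f t) := fun t => semH_nonneg _ _ _
  have φ0 : ∀ t, 0 ≤ semN 1 (f t) := fun t => semN_nonneg _ _
  have hb := fun τ hτ => h.semN_one_le hL hLt (τ := τ) hτ
  have step : ∀ τ ∈ Icc t0 t1, semH N α (u τ) ≤ exp 1 * (semH N α (u t0)
      + ∫ s in t0..τ, (semH N α (f s) + 2 ^ N * (c * (L * semH N α (u s) + A * semN 1 (u s))))) := by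
    intro τ hτ
    have hi : 0 ≤ ∫ s in t0..τ, (semH N α (f s)
        + 2 ^ N * (c * (L * semH N α (u s) + A * semN 1 (u s)))) :=
      intervalIntegral.integral_nonneg hτ.1 fun s _ => by
        have := y0 s
        have := b0 s
        have := F0 s
        positivity
    refine ((h.mono hτ).semH_le N (Q := fun s => c * (L * semH N α (u s) + A * semN 1 (u s)))
      (fun t ht => hL t ⟨ht.1, ht.2.trans hτ.2⟩) hα0 hα1 (fun t _ => ?_)
      (by fun_prop) (fun t ht j k hjk => ?_)).trans ?_
    · have := y0 t
      have := b0 t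
      positivity
    · have ht' : t ∈ Icc t0 t1 := ⟨ht.1, ht.2.trans hτ.2⟩
      refine (hprod t j k hjk).trans (mul_le_mul_of_nonneg_left (add_le_add ?_ ?_) hc)
      · exact mul_le_mul_of_nonneg_right (hL t ht') (y0 t)
      · exact mul_le_mul_of_nonneg_right (hA t ht') (b0 t)
    · refine mul_le_mul_of_nonneg_right ?_ (add_nonneg (y0 _) hi)
      rw [Real.exp_le_exp]
      have h1 : L * (τ - t0) ≤ 1 := by nlinarith [hτ.2]
      have h2 : 0 ≤ L * (τ - t0) := mul_nonneg hL0 (sub_nonneg.2 hτ.1)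
      nlinarith
  set G0 := semH N α (u t0) + (∫ s in t0..t1, semH N α (f s))
    + 2 ^ N * c * A * ∫ s in t0..t1, semN 1 (u s) with hG0
  have iF : 0 ≤ ∫ s in t0..t1, semH N α (f s) :=
    intervalIntegral.integral_nonneg hle fun _ _ => F0 _
  have ib : 0 ≤ ∫ s in t0..t1, semN 1 (u s) :=
    intervalIntegral.integral_nonneg hle fun _ _ => b0 _
  have hG00 : 0 ≤ G0 := by
    have := y0 t0
    positivity
  have gron := gronwall_integral (y := fun t => semH N α (u t)) (G := exp 1 * G0)
    (k := exp 1 * 2 ^ N * c * L) (a := t0) (b := t1) cy y0 (by positivity) (by positivity) hle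
    (fun τ hτ => by
      refine (step τ hτ).trans ?_
      have e : ∫ s in t0..τ, (semH N α (f s) + 2 ^ N * (c * (L * semH N α (u s) + A * semN 1 (u s))))
          = (∫ s in t0..τ, semH N α (f s)) + (2 ^ N * c * L * (∫ s in t0..τ, semH N α (u s))
            + 2 ^ N * c * A * ∫ s in t0..τ, semN 1 (u s)) := by
        rw [← intervalIntegral.integral_const_mul, ← intervalIntegral.integral_const_mul,
          ← intervalIntegral.integral_add, ← intervalIntegral.integral_add]
        · congr 1
          funext s
          ring
        all_goals exact Continuous.intervalIntegrable (by fun_prop) _ _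
      have mF : ∫ s in t0..τ, semH N α (f s) ≤ ∫ s in t0..t1, semH N α (f s) :=
        intervalIntegral.integral_mono_interval le_rfl hτ.1 hτ.2
          (Eventually.of_forall F0) (cF.intervalIntegrable _ _)
      have mb : ∫ s in t0..τ, semN 1 (u s) ≤ ∫ s in t0..t1, semN 1 (u s) :=
        intervalIntegral.integral_mono_interval le_rfl hτ.1 hτ.2
          (Eventually.of_forall b0) (cb.intervalIntegrable _ _)
      have mb' := mul_le_mul_of_nonneg_left mb (by positivity : 0 ≤ 2 ^ N * c * A)
      rw [e]
      have : exp 1 * G0 + exp 1 * 2 ^ N * c * L * ∫ s in t0..τ, semH N α (u s)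
          = exp 1 * (G0 + 2 ^ N * c * L * ∫ s in t0..τ, semH N α (u s)) := by ring
      rw [this]
      refine mul_le_mul_of_nonneg_left ?_ (exp_pos 1).le
      linarith)
  have intb : ∫ s in t0..t1, semN 1 (u s)
      ≤ exp 1 * ((t1 - t0) * semN 1 (u t0) + ∫ s in t0..t1, (t1 - s) * semN 1 (f s)) := by
    have cI : Continuous fun τ => ∫ s in t0..τ, semN 1 (f s) :=
      continuous_iff_continuousAt.2 fun x => (hasDerivAt_primitive cφ t0 x).continuousAt
    refine (intervalIntegral.integral_mono_on hle (cb.intervalIntegrable _ _)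
      (Continuous.intervalIntegrable (by fun_prop) _ _) hb).trans (le_of_eq ?_)
    rw [intervalIntegral.integral_const_mul, intervalIntegral.integral_add
      (continuous_const.intervalIntegrable _ _) (cI.intervalIntegrable _ _),
      intervalIntegral.integral_const, integral_integral_eq cφ, smul_eq_mul]
  have iφ : 0 ≤ ∫ s in t0..t1, (t1 - s) * semN 1 (f s) :=
    intervalIntegral.integral_nonneg hle fun s hs => mul_nonneg (sub_nonneg.2 hs.2) (φ0 s)
  have eR : ∫ τ in t0..t1, (semH N α (f τ) + (t1 - τ) * A * semN 1 (f τ))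
      = (∫ τ in t0..t1, semH N α (f τ)) + A * ∫ s in t0..t1, (t1 - s) * semN 1 (f s) := by
    rw [← intervalIntegral.integral_const_mul, ← intervalIntegral.integral_add]
    · congr 1
      funext s
      ring
    all_goals exact Continuous.intervalIntegrable (by fun_prop) _ _
  rw [eR]
  set J := ∫ s in t0..t1, (t1 - s) * semN 1 (f s)
  set I := ∫ s in t0..t1, semH N α (f s)
  have hkt : exp (exp 1 * 2 ^ N * c * L * (t1 - t0)) ≤ exp (exp 1 * 2 ^ N * c) := by
    rw [Real.exp_le_exp, mul_assoc]
    exact mul_le_of_le_one_right (by positivity) (by linarith)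
  have ht : 0 ≤ t1 - t0 := sub_nonneg.2 hle
  have hX : 0 ≤ semH N α (u t0) + I := add_nonneg (y0 _) iF
  have hY : 0 ≤ (t1 - t0) * A * semN 1 (u t0) + A * J := by
    have := b0 t0
    positivity
  have hG : G0 ≤ (1 + 2 ^ N * c * exp 1)
      * (semH N α (u t0) + (t1 - t0) * A * semN 1 (u t0) + (I + A * J)) := by
    have h1 := mul_le_mul_of_nonneg_left intb (by positivity : 0 ≤ 2 ^ N * c * A)
    have h2 : 0 ≤ 2 ^ N * c * exp 1 * (semH N α (u t0) + I) := by positivity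
    rw [hG0]
    linarith
  refine gron.trans ?_
  calc exp 1 * G0 * exp (exp 1 * 2 ^ N * c * L * (t1 - t0))
      ≤ exp 1 * G0 * exp (exp 1 * 2 ^ N * c) := mul_le_mul_of_nonneg_left hkt (by positivity)
    _ = exp 1 * exp (exp 1 * 2 ^ N * c) * G0 := by ring
    _ ≤ exp 1 * exp (exp 1 * 2 ^ N * c) * ((1 + 2 ^ N * c * exp 1)
      * (semH N α (u t0) + (t1 - t0) * A * semN 1 (u t0) + (I + A * J))) :=
        mul_le_mul_of_nonneg_left hG (by positivity)
    _ = _ := by ring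

end Sol

/-- Hölder stability for the non-local advection-diffusion equation
`∂_t u + (v·∇)u + ν(-Δ)^γ u = f`: if `0 ≤ (t-t₀)[v]₁ ≤ 1` then
`‖u(t)‖_α ≤ e^α(‖u₀‖_α + ∫ ‖f‖_α)` for `0 ≤ α ≤ 1`, and for `N ≥ 1`, `0 ≤ α < 1`,
`[u(t)]_{N+α} ≲ [u₀]_{N+α} + (t-t₀)[v]_{N+α}[u₀]₁ + ∫ ([f]_{N+α} + (t-τ)[v]_{N+α}[f]₁)`,
with implicit constant depending only on `N` and `α`. -/
theorem holder_stability (N : ℕ) (hN : 1 ≤ N) (α : ℝ) (hα0 : 0 ≤ α) (hα1 : α < 1) :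
    ∃ C : ℝ, 0 < C ∧
    ∀ (ν γ t0 T : ℝ) (v u f : ℝ → Sp → V3) (u0 : Sp → V3),
      0 ≤ ν → 0 < γ → γ ≤ 1 → t0 ≤ T →
      SmoothST v → PerT v → SmoothST u → PerT u → SmoothST f → PerT f →
      u t0 = u0 →
      (∀ t ∈ Set.Ioo t0 T, ∀ x : Sp, ∀ j,
        matder v u t x j + ν * fracLapV γ (u t) x j = f t x j) →
      ∀ t ∈ Set.Icc t0 T, (t - t0) * semNT 1 v t0 T ≤ 1 →
        (∀ α' : ℝ, 0 ≤ α' → α' ≤ 1 →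
          nrmH α' (u t) ≤ Real.exp α' * (nrmH α' u0 + ∫ τ in t0..t, nrmH α' (f τ))) ∧
        semH N α (u t) ≤ C * (semH N α u0 + (t - t0) * semHT N α v t0 T * semN 1 u0
          + ∫ τ in t0..t, (semH N α (f τ) + (t - τ) * semHT N α v t0 T * semN 1 (f τ))) := by
  obtain ⟨c, hc, hprod⟩ := interp_product N α hα0 hα1.le
  refine ⟨exp 1 * exp (exp 1 * 2 ^ N * c) * (1 + 2 ^ N * c * exp 1), by positivity, ?_⟩
  intro ν γ t0 T v u f u0 hν hγ hγ1 hT hv pv hu pu hf pf hu0 heq t ht hLt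
  have h : Sol ν γ t0 t v u f := (Sol.mk hν hγ hγ1 hT hv pv hu pu hf pf heq).mono ht
  have hsub : ∀ s ∈ Icc t0 t, s ∈ Icc t0 T := fun s hs => ⟨hs.1, hs.2.trans ht.2⟩
  have hL : ∀ s ∈ Icc t0 t, semN 1 (v s) ≤ semNT 1 v t0 T := fun s hs =>
    semN_le_semNT hv pv 1 (hsub s hs)
  subst hu0
  exact ⟨fun α' h0 h1 => h.nrmH_le hL hLt h0 h1,
    h.semH_succ_le N hc hα0 hα1.le hL hLt
      (fun s hs => semH_le_semHT hv pv N hα0 hα1.le (hsub s hs)) (hprod v u hv pv hu pu)⟩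

end FNS
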